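/- Under the two-group random mixture model, for every α∈[0,1] the limit lim_{n→∞} FNR*_n(α) exists and equals b**(α). -/

import Mathlib

open MeasureTheory ProbabilityTheory Filter

namespace TwoGroup

/-- The two-group random mixture model: a σ-finite base measure on the sample space `𝒳`,
a null proportion `π0 ∈ (0,1)`, and null/non-null probability density functions `f0`, `f1`
with respect to the base measure. -/
structure Model (𝒳 : Type*) [MeasurableSpace 𝒳] where
  base : Measure 𝒳
  sigmaFinite : SigmaFinite base
  π0 : ℝ
  π0_mem : π0 ∈ Set.Ioo (0 : ℝ) 1
  f0 : 𝒳 → ℝ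
  f1 : 𝒳 → ℝ
  f0_meas : Measurable f0
  f1_meas : Measurable f1
  f0_nonneg : ∀ x, 0 ≤ f0 x
  f1_nonneg : ∀ x, 0 ≤ f1 x
  f0_prob : IsProbabilityMeasure (base.withDensity fun x => ENNReal.ofReal (f0 x))
  f1_prob : IsProbabilityMeasure (base.withDensity fun x => ENNReal.ofReal (f1 x))

namespace Model

variable {𝒳 : Type*} [MeasurableSpace 𝒳] (M : Model 𝒳)

/-- The non-null proportion `π1 = 1 - π0`. -/
noncomputable def π1 : ℝ := 1 - M.π0

/-- The marginal density `f = π0 f0 + π1 f1`. -/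
noncomputable def f (x : 𝒳) : ℝ := M.π0 * M.f0 x + M.π1 * M.f1 x

/-- The local false discovery rate `Lfdr(x) = π0 f0(x) / f(x)`. -/
noncomputable def Lfdr (x : 𝒳) : ℝ := M.π0 * M.f0 x / M.f x

/-- The joint law of a single pair `(θ, X)`; `true` encodes `θ = 1` (non-null). -/
noncomputable def joint : Measure (Bool × 𝒳) :=
  (ENNReal.ofReal M.π0) •
      ((Measure.dirac false).prod (M.base.withDensity fun x => ENNReal.ofReal (M.f0 x))) +
    (ENNReal.ofReal M.π1) •
      ((Measure.dirac true).prod (M.base.withDensity fun x => ENNReal.ofReal (M.f1 x)))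

/-- The joint law of `((θ1, X1), …, (θn, Xn))`: i.i.d. copies of `(θ, X)`. -/
noncomputable def jointN (n : ℕ) : Measure (Fin n → Bool × 𝒳) :=
  Measure.pi fun _ => M.joint

end Model

/-- Number of rejections `Σ_i δ_i`. -/
def nRej {n : ℕ} (d : Fin n → Bool) : ℝ := ∑ i, if d i then (1 : ℝ) else 0

/-- Number of false discoveries `Σ_i δ_i (1 - θ_i)`. -/
def nFD {n : ℕ} (θ d : Fin n → Bool) : ℝ :=
  ∑ i, (if d i then (1 : ℝ) else 0) * (if θ i then (0 : ℝ) else 1)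

/-- Number of acceptances `Σ_i (1 - δ_i)`. -/
def nAcc {n : ℕ} (d : Fin n → Bool) : ℝ := ∑ i, if d i then (0 : ℝ) else 1

/-- Number of false non-discoveries `Σ_i (1 - δ_i) θ_i`. -/
def nFN {n : ℕ} (θ d : Fin n → Bool) : ℝ :=
  ∑ i, (if d i then (0 : ℝ) else 1) * (if θ i then (1 : ℝ) else 0)

/-- False discovery proportion. -/
noncomputable def FDP {n : ℕ} (θ d : Fin n → Bool) : ℝ := nFD θ d / max 1 (nRej d)

/-- False non-discovery proportion. -/
noncomputable def FNP {n : ℕ} (θ d : Fin n → Bool) : ℝ := nFN θ d / max 1 (nAcc d)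

/-- A decision rule is a Markov kernel from `𝒳^n` to `{0,1}^n`: a measurable family of
probability measures on `Fin n → Bool`. -/
def IsRule {𝒳 : Type*} [MeasurableSpace 𝒳] {n : ℕ}
    (κ : (Fin n → 𝒳) → Measure (Fin n → Bool)) : Prop :=
  Measurable κ ∧ ∀ x, IsProbabilityMeasure (κ x)

namespace Model

variable {𝒳 : Type*} [MeasurableSpace 𝒳] (M : Model 𝒳)

/-- The false discovery rate `FDR = E[FDP]` of a (randomized) decision rule. -/
noncomputable def FDR (n : ℕ) (κ : (Fin n → 𝒳) → Measure (Fin n → Bool)) : ℝ :=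
  ∫ ω, ∫ d, FDP (fun i => (ω i).1) d ∂(κ fun i => (ω i).2) ∂(M.jointN n)

/-- The false non-discovery rate `FNR = E[FNP]` of a (randomized) decision rule. -/
noncomputable def FNR (n : ℕ) (κ : (Fin n → 𝒳) → Measure (Fin n → Bool)) : ℝ :=
  ∫ ω, ∫ d, FNP (fun i => (ω i).1) d ∂(κ fun i => (ω i).2) ∂(M.jointN n)

/-- The marginal FDR `mFDR = E[Σ δi (1-θi)] / E[Σ δi]` (with `0/0 = 0`). -/
noncomputable def mFDR (n : ℕ) (κ : (Fin n → 𝒳) → Measure (Fin n → Bool)) : ℝ :=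
  (∫ ω, ∫ d, nFD (fun i => (ω i).1) d ∂(κ fun i => (ω i).2) ∂(M.jointN n)) /
    (∫ ω, ∫ d, nRej d ∂(κ fun i => (ω i).2) ∂(M.jointN n))

/-- The marginal FNR `mFNR = E[Σ (1-δi) θi] / E[Σ (1-δi)]` (with `0/0 = 0`). -/
noncomputable def mFNR (n : ℕ) (κ : (Fin n → 𝒳) → Measure (Fin n → Bool)) : ℝ :=
  (∫ ω, ∫ d, nFN (fun i => (ω i).1) d ∂(κ fun i => (ω i).2) ∂(M.jointN n)) /
    (∫ ω, ∫ d, nAcc d ∂(κ fun i => (ω i).2) ∂(M.jointN n))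

/-- `FNR*_n(α)`: the minimum FNR over decision rules controlling FDR at level `α`. -/
noncomputable def FNRstar (n : ℕ) (α : ℝ) : ℝ :=
  sInf {r | ∃ κ : (Fin n → 𝒳) → Measure (Fin n → Bool),
    IsRule κ ∧ M.FDR n κ ≤ α ∧ r = M.FNR n κ}

/-- The minimum mFNR over decision rules for `n` hypotheses controlling mFDR at level `α`. -/
noncomputable def mFNRstarN (n : ℕ) (α : ℝ) : ℝ :=
  sInf {r | ∃ κ : (Fin n → 𝒳) → Measure (Fin n → Bool),
    IsRule κ ∧ M.mFDR n κ ≤ α ∧ r = M.mFNR n κ}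

/-- `mFNR*(α)` (this quantity does not depend on the number of hypotheses; we take `n = 1`). -/
noncomputable def mFNRstar (α : ℝ) : ℝ := M.mFNRstarN 1 α

/-- The marginal law of a single observation `X ∼ f`. -/
noncomputable def Pmix : Measure 𝒳 := M.base.withDensity fun x => ENNReal.ofReal (M.f x)

/-- The law of `W = Lfdr(X)`, `X ∼ f`. -/
noncomputable def νW : Measure ℝ := M.Pmix.map M.Lfdr

/-- `G(t) = P(W ≤ t)`. -/
noncomputable def G (t : ℝ) : ℝ := (M.νW (Set.Iic t)).toReal

/-- `Ḡ(t) = P(W < t)`. -/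
noncomputable def Gbar (t : ℝ) : ℝ := (M.νW (Set.Iio t)).toReal

/-- The generalized inverse `G^{-1}(u) = inf{t : G(t) ≥ u}`. -/
noncomputable def Ginv (u : ℝ) : ℝ := sInf {t | u ≤ M.G t}

/-- `P(W = t)`. -/
noncomputable def atom (t : ℝ) : ℝ := (M.νW {t}).toReal

/-- The randomization probability `p(u)`, satisfying
`Ḡ(G^{-1}(u)) + p(u) P(W = G^{-1}(u)) = u`. -/
noncomputable def pu (u : ℝ) : ℝ := (u - M.Gbar (M.Ginv u)) / M.atom (M.Ginv u)

/-- `a(u) = E[W | S_u = 1]` for `u ∈ (0,1]`, `a(0) = 0`, where `S_u` is the Bernoulli(u)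
thresholding variable of `W` at `G^{-1}(u)` with randomization `p(u)` at the boundary. -/
noncomputable def a (u : ℝ) : ℝ :=
  if u = 0 then 0
  else ((∫ w in Set.Iio (M.Ginv u), w ∂M.νW) + M.pu u * (M.Ginv u * M.atom (M.Ginv u))) / u

/-- `b(u) = E[1 - W | S_u = 0]` for `u ∈ [0,1)`, `b(1) = 0`. -/
noncomputable def b (u : ℝ) : ℝ :=
  if u = 1 then 0
  else ((∫ w in Set.Ioi (M.Ginv u), (1 - w) ∂M.νW)
      + (1 - M.pu u) * ((1 - M.Ginv u) * M.atom (M.Ginv u))) / (1 - u)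

/-- `b*(α) = inf{b(u) : u ∈ [0,1], a(u) ≤ α}`. -/
noncomputable def bstar (α : ℝ) : ℝ :=
  sInf {y | ∃ u ∈ Set.Icc (0 : ℝ) 1, M.a u ≤ α ∧ y = M.b u}

/-- `u*(α) = sup{u ∈ [0,1] : a(u) ≤ α}`. -/
noncomputable def ustar (α : ℝ) : ℝ :=
  sSup {u | u ∈ Set.Icc (0 : ℝ) 1 ∧ M.a u ≤ α}

/-- `b**(α) = inf{E[b(U)] : U a [0,1]-valued random variable with E[a(U)] ≤ α}`. -/
noncomputable def bstarstar (α : ℝ) : ℝ :=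
  sInf {y | ∃ ρ : Measure ℝ, IsProbabilityMeasure ρ ∧ (∀ᵐ u ∂ρ, u ∈ Set.Icc (0 : ℝ) 1) ∧
    (∫ u, M.a u ∂ρ) ≤ α ∧ y = ∫ u, M.b u ∂ρ}

end Model

/-- The Bernoulli(p) measure on `Bool`. -/
noncomputable def bern (p : ℝ) : Measure Bool :=
  (ENNReal.ofReal p) • Measure.dirac true + (ENNReal.ofReal (1 - p)) • Measure.dirac false

namespace Model

variable {𝒳 : Type*} [MeasurableSpace 𝒳] (M : Model 𝒳)

/-- The per-observation rejection probability of the Neyman–Pearson rule at level `α`: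
reject if `Lfdr(x) < G^{-1}(u*(α))`, randomize with probability `p(u*(α))` at equality,
and accept otherwise. -/
noncomputable def qNP (α : ℝ) (x : 𝒳) : ℝ :=
  if M.Lfdr x < M.Ginv (M.ustar α) then 1
  else if M.Lfdr x = M.Ginv (M.ustar α) then M.pu (M.ustar α)
  else 0

/-- The Neyman–Pearson rule `δ^n_NP(α)`, as a Markov kernel: independent randomized
likelihood-ratio tests applied to each observation. -/
noncomputable def NP (α : ℝ) (n : ℕ) : (Fin n → 𝒳) → Measure (Fin n → Bool) :=
  fun x => Measure.pi fun i => bern (M.qNP α (x i))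

/-- The probability (over data and the randomization of the rule `κ`) that the decision vector
lies in the set `E θ` (which may depend on the true labels `θ`). -/
noncomputable def prob (n : ℕ) (κ : (Fin n → 𝒳) → Measure (Fin n → Bool))
    (E : (Fin n → Bool) → Set (Fin n → Bool)) : ℝ :=
  (∫⁻ ω, κ (fun i => (ω i).2) (E fun i => (ω i).1) ∂(M.jointN n)).toReal

end Model

/-- `sortedVal n w i` is the `i`-th order statistic `w_(i)` (for `1 ≤ i ≤ n`) of
`w 0, …, w (n-1)`. -/
noncomputable def sortedVal (n : ℕ) (w : Fin n → ℝ) (i : ℕ) : ℝ :=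
  ((Multiset.map w Finset.univ.val).sort (· ≤ ·)).getD (i - 1) 0

/-- `avgLow n w k = (1/k) Σ_{i=1}^k w_(i)` (equal to `0` when `k = 0`). -/
noncomputable def avgLow (n : ℕ) (w : Fin n → ℝ) (k : ℕ) : ℝ :=
  (∑ i ∈ Finset.Icc 1 k, sortedVal n w i) / k

/-- `avgHigh n w k = (1/(n-k)) Σ_{i=k+1}^n (1 - w_(i))` (equal to `0` when `k = n`). -/
noncomputable def avgHigh (n : ℕ) (w : Fin n → ℝ) (k : ℕ) : ℝ :=
  (∑ i ∈ Finset.Icc (k + 1) n, (1 - sortedVal n w i)) / ((n : ℝ) - k)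

/-- The greatest convex minorant on `[0,1]` of a function `h`, evaluated at `α`. -/
noncomputable def gcm (h : ℝ → ℝ) (α : ℝ) : ℝ :=
  sSup {y | ∃ C : ℝ → ℝ, ConvexOn ℝ (Set.Icc 0 1) C ∧
    (∀ t ∈ Set.Icc (0 : ℝ) 1, C t ≤ h t) ∧ y = C α}

end TwoGroup

namespace TwoGroup

namespace Model

variable {𝒳 : Type*} [MeasurableSpace 𝒳] (M : Model 𝒳)

lemma π1_pos : 0 < M.π1 := sub_pos.2 M.π0_mem.2

lemma f_nonneg (x : 𝒳) : 0 ≤ M.f x :=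
  add_nonneg (mul_nonneg M.π0_mem.1.le (M.f0_nonneg x)) (mul_nonneg M.π1_pos.le (M.f1_nonneg x))

lemma π0_mul_f0_le_f (x : 𝒳) : M.π0 * M.f0 x ≤ M.f x :=
  le_add_of_nonneg_right (mul_nonneg M.π1_pos.le (M.f1_nonneg x))

lemma measurable_f : Measurable M.f :=
  (M.f0_meas.const_mul _).add (M.f1_meas.const_mul _)

lemma measurable_Lfdr : Measurable M.Lfdr :=
  (M.f0_meas.const_mul _).div M.measurable_f

lemma Lfdr_nonneg (x : 𝒳) : 0 ≤ M.Lfdr x :=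
  div_nonneg (mul_nonneg M.π0_mem.1.le (M.f0_nonneg x)) (M.f_nonneg x)

lemma Lfdr_le_one (x : 𝒳) : M.Lfdr x ≤ 1 :=
  div_le_one_of_le₀ (M.π0_mul_f0_le_f x) (M.f_nonneg x)

lemma Lfdr_mul_f (x : 𝒳) : M.Lfdr x * M.f x = M.π0 * M.f0 x := by
  rcases eq_or_ne (M.f x) 0 with h | h
  · have h1 := M.π0_mul_f0_le_f x
    have h2 := mul_nonneg M.π0_mem.1.le (M.f0_nonneg x)
    rw [h, mul_zero]
    linarith
  · exact div_mul_cancel₀ _ h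

lemma lintegral_joint {F : Bool × 𝒳 → ENNReal} (hF : Measurable F) :
    ∫⁻ y, F y ∂M.joint = ∫⁻ x, ENNReal.ofReal (M.π0 * M.f0 x) * F (false, x) ∂M.base +
      ∫⁻ x, ENNReal.ofReal (M.π1 * M.f1 x) * F (true, x) ∂M.base := by
  have := M.f0_prob
  have := M.f1_prob
  have h0 : Measurable fun x => F (false, x) := hF.comp measurable_prodMk_left
  have h1 : Measurable fun x => F (true, x) := hF.comp measurable_prodMk_left
  rw [joint, lintegral_add_measure, lintegral_smul_measure, lintegral_smul_measure,
    Measure.dirac_prod, Measure.dirac_prod, lintegral_map hF measurable_prodMk_left,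
    lintegral_map hF measurable_prodMk_left,
    lintegral_withDensity_eq_lintegral_mul _ M.f0_meas.ennreal_ofReal h0,
    lintegral_withDensity_eq_lintegral_mul _ M.f1_meas.ennreal_ofReal h1, smul_eq_mul, smul_eq_mul,
    ← lintegral_const_mul _ (M.f0_meas.ennreal_ofReal.mul h0),
    ← lintegral_const_mul _ (M.f1_meas.ennreal_ofReal.mul h1)]
  simp only [Pi.mul_apply, ENNReal.ofReal_mul M.π0_mem.1.le, ENNReal.ofReal_mul M.π1_pos.le,
    mul_assoc]

lemma lintegral_joint_snd {h : 𝒳 → ENNReal} (hh : Measurable h) :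
    ∫⁻ y, h y.2 ∂M.joint = ∫⁻ x, h x ∂M.Pmix := by
  rw [M.lintegral_joint (F := fun y => h y.2) (hh.comp measurable_snd), Pmix,
    lintegral_withDensity_eq_lintegral_mul _ M.measurable_f.ennreal_ofReal hh,
    ← lintegral_add_left (f := fun x => ENNReal.ofReal (M.π0 * M.f0 x) * h x)
      ((M.f0_meas.const_mul _).ennreal_ofReal.mul hh)]
  refine lintegral_congr fun x => ?_
  rw [Pi.mul_apply, f, ENNReal.ofReal_add (mul_nonneg M.π0_mem.1.le (M.f0_nonneg x))
    (mul_nonneg M.π1_pos.le (M.f1_nonneg x)), add_mul]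

lemma map_snd_joint : M.joint.map Prod.snd = M.Pmix := by
  ext s hs
  rw [Measure.map_apply measurable_snd hs, ← lintegral_indicator_one hs,
    ← lintegral_indicator_one (measurable_snd hs), ← M.lintegral_joint_snd (measurable_one.indicator hs)]
  rfl

instance isProbabilityMeasure_joint : IsProbabilityMeasure M.joint := by
  have := M.f0_prob
  have := M.f1_prob
  constructor
  simp only [joint, Measure.coe_add, Measure.coe_smul, Pi.add_apply, Pi.smul_apply, measure_univ,
    smul_eq_mul, mul_one]
  rw [← ENNReal.ofReal_add M.π0_mem.1.le M.π1_pos.le, π1]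
  simp

instance isProbabilityMeasure_jointN (n : ℕ) : IsProbabilityMeasure (M.jointN n) := by
  unfold jointN
  infer_instance

lemma measurable_Lfdr_snd : Measurable fun y : Bool × 𝒳 => M.Lfdr y.2 :=
  M.measurable_Lfdr.comp measurable_snd

lemma map_Lfdr_joint : M.joint.map (fun y => M.Lfdr y.2) = M.νW := by
  rw [νW, ← M.map_snd_joint, Measure.map_map M.measurable_Lfdr measurable_snd]
  rfl

instance isProbabilityMeasure_νW : IsProbabilityMeasure M.νW := by
  rw [← M.map_Lfdr_joint]
  exact Measure.isProbabilityMeasure_map M.measurable_Lfdr_snd.aemeasurable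

lemma integral_comp_Lfdr {h : ℝ → ℝ} (hh : Measurable h) :
    ∫ y, h (M.Lfdr y.2) ∂M.joint = ∫ w, h w ∂M.νW := by
  rw [← M.map_Lfdr_joint, integral_map M.measurable_Lfdr_snd.aemeasurable
    hh.aestronglyMeasurable]

lemma ae_νW_mem : ∀ᵐ w ∂M.νW, w ∈ Set.Icc (0 : ℝ) 1 := by
  rw [← M.map_Lfdr_joint]
  refine (ae_map_iff M.measurable_Lfdr_snd.aemeasurable measurableSet_Icc).2 ?_
  exact ae_of_all _ fun y => ⟨M.Lfdr_nonneg _, M.Lfdr_le_one _⟩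

lemma lintegral_null {h : 𝒳 → ENNReal} (hh : Measurable h) :
    ∫⁻ y, h y.2 * (if y.1 then 0 else 1) ∂M.joint =
      ∫⁻ y, h y.2 * ENNReal.ofReal (M.Lfdr y.2) ∂M.joint := by
  have hi : Measurable fun y : Bool × 𝒳 => (if y.1 then (0 : ENNReal) else 1) :=
    (measurable_from_top (f := fun b : Bool => if b then (0 : ENNReal) else 1)).comp measurable_fst
  have hL := M.measurable_Lfdr
  have hf := M.measurable_f
  rw [M.lintegral_joint (F := fun y => h y.2 * (if y.1 then 0 else 1))
      ((hh.comp measurable_snd).mul hi),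
    M.lintegral_joint_snd (h := fun x => h x * ENNReal.ofReal (M.Lfdr x)) (by fun_prop), Pmix,
    lintegral_withDensity_eq_lintegral_mul _ hf.ennreal_ofReal (by fun_prop)]
  simp only [if_true, mul_zero, lintegral_zero, add_zero]
  refine lintegral_congr fun x => ?_
  rw [Pi.mul_apply, ← M.Lfdr_mul_f, ENNReal.ofReal_mul (M.Lfdr_nonneg x)]
  simp only [Bool.false_eq_true, if_false]
  ring

lemma measurable_snd_pi (n : ℕ) : Measurable fun (ω : Fin n → Bool × 𝒳) i => (ω i).2 := by
  fun_prop

/-- The conditional probability that the `i`-th hypothesis is null given the data is `W i`. -/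
lemma integral_null {n : ℕ} {g : (Fin n → 𝒳) → ℝ} (hg : Measurable g) (hg0 : ∀ x, 0 ≤ g x)
    (i : Fin n) :
    ∫ ω, g (fun j => (ω j).2) * (if (ω i).1 then 0 else 1) ∂M.jointN n =
      ∫ ω, g (fun j => (ω j).2) * M.Lfdr (ω i).2 ∂M.jointN n := by
  have hs := measurable_snd_pi (𝒳 := 𝒳) n
  have hL := M.measurable_Lfdr
  have hi : Measurable fun y : Bool × 𝒳 => (if y.1 then (0 : ℝ) else 1) :=
    (measurable_from_top (f := fun b : Bool => if b then (0 : ℝ) else 1)).comp measurable_fst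
  have m1 : Measurable fun ω : Fin n → Bool × 𝒳 =>
      g (fun j => (ω j).2) * (if (ω i).1 then 0 else 1) :=
    (hg.comp hs).mul (hi.comp (measurable_pi_apply i))
  have m2 : Measurable fun ω : Fin n → Bool × 𝒳 => g (fun j => (ω j).2) * M.Lfdr (ω i).2 :=
    (hg.comp hs).mul (hL.comp (measurable_snd.comp (measurable_pi_apply i)))
  rw [integral_eq_lintegral_of_nonneg_ae _ m1.aestronglyMeasurable,
    integral_eq_lintegral_of_nonneg_ae _ m2.aestronglyMeasurable]
  rotate_left
  · exact ae_of_all _ fun ω => mul_nonneg (hg0 _) (M.Lfdr_nonneg _)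
  · exact ae_of_all _ fun ω => mul_nonneg (hg0 _) (by split_ifs <;> norm_num)
  congr 1
  refine lintegral_eq_of_lmarginal_eq {i} m1.ennreal_ofReal m2.ennreal_ofReal ?_
  rw [lmarginal_singleton, lmarginal_singleton]
  funext ω
  have key := M.lintegral_null
    (h := fun x => ENNReal.ofReal (g (Function.update (fun j => (ω j).2) i x)))
    ((hg.comp (measurable_update _)).ennreal_ofReal)
  have hu (y : Bool × 𝒳) : (fun j => (Function.update ω i y j).2) =
      Function.update (fun j => (ω j).2) i y.2 := by
    funext j
    by_cases h : j = i
    · subst h; simp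
    · simp [h]
  simp only [hu, Function.update_self, ENNReal.ofReal_mul (hg0 _)]
  convert key using 4 with y
  split_ifs <;> simp

lemma integral_nonnull {n : ℕ} {g : (Fin n → 𝒳) → ℝ} (hg : Measurable g) (hg0 : ∀ x, 0 ≤ g x)
    (hg1 : ∀ x, g x ≤ 1) (i : Fin n) :
    ∫ ω, g (fun j => (ω j).2) * (if (ω i).1 then 1 else 0) ∂M.jointN n =
      ∫ ω, g (fun j => (ω j).2) * (1 - M.Lfdr (ω i).2) ∂M.jointN n := by
  have hs := measurable_snd_pi (𝒳 := 𝒳) n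
  have hL := M.measurable_Lfdr
  have hi : Measurable fun y : Bool × 𝒳 => (if y.1 then (0 : ℝ) else 1) :=
    (measurable_from_top (f := fun b : Bool => if b then (0 : ℝ) else 1)).comp measurable_fst
  have i0 : Integrable (fun ω : Fin n → Bool × 𝒳 => g (fun j => (ω j).2)) (M.jointN n) :=
    Integrable.of_bound (hg.comp hs).aestronglyMeasurable 1
      (ae_of_all _ fun ω => by rw [Real.norm_eq_abs, abs_of_nonneg (hg0 _)]; exact hg1 _)
  have i1 : Integrable (fun ω : Fin n → Bool × 𝒳 =>
      g (fun j => (ω j).2) * (if (ω i).1 then 0 else 1)) (M.jointN n) :=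
    i0.mul_bdd (c := 1) (hi.comp (measurable_pi_apply i)).aestronglyMeasurable
      (ae_of_all _ fun ω => by split_ifs <;> norm_num)
  have i2 : Integrable (fun ω : Fin n → Bool × 𝒳 =>
      g (fun j => (ω j).2) * M.Lfdr (ω i).2) (M.jointN n) :=
    i0.mul_bdd (c := 1)
      (hL.comp (measurable_snd.comp (measurable_pi_apply i))).aestronglyMeasurable
      (ae_of_all _ fun ω => by
        rw [Real.norm_eq_abs, abs_of_nonneg (M.Lfdr_nonneg _)]; exact M.Lfdr_le_one _)
  have h := M.integral_null hg hg0 i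
  have e1 (ω : Fin n → Bool × 𝒳) : g (fun j => (ω j).2) * (if (ω i).1 then 1 else 0) =
      g (fun j => (ω j).2) - g (fun j => (ω j).2) * (if (ω i).1 then 0 else 1) := by
    split_ifs <;> ring
  simp only [e1, mul_sub, mul_one]
  rw [integral_sub i0 i1, integral_sub i0 i2, h]

end Model

namespace Model

variable {𝒳 : Type*} [MeasurableSpace 𝒳] (M : Model 𝒳)

lemma G_eq_cdf (t : ℝ) : M.G t = cdf M.νW t := (cdf_eq_real M.νW t).symm

lemma G_mono : Monotone M.G := fun s t h => by
  rw [G_eq_cdf, G_eq_cdf]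
  exact monotone_cdf _ h

lemma G_of_neg {t : ℝ} (ht : t < 0) : M.G t = 0 := by
  have : M.νW (Set.Iic t) = 0 :=
    measure_eq_zero_iff_ae_notMem.2 (M.ae_νW_mem.mono fun w h hw =>
      absurd (h.1.trans hw) (not_le.2 ht))
  rw [G, this, ENNReal.toReal_zero]

lemma G_of_one_le {t : ℝ} (ht : 1 ≤ t) : M.G t = 1 := by
  have : M.νW (Set.Iic t) = 1 :=
    (mem_ae_iff_prob_eq_one measurableSet_Iic).1 (M.ae_νW_mem.mono fun w hw => hw.2.trans ht)
  rw [G, this, ENNReal.toReal_one]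

lemma G_nonneg (t : ℝ) : 0 ≤ M.G t := ENNReal.toReal_nonneg

lemma G_le_one (t : ℝ) : M.G t ≤ 1 := by
  rw [G_eq_cdf]
  exact cdf_le_one _ _

lemma Gbar_zero : M.Gbar 0 = 0 := by
  have : M.νW (Set.Iio 0) = 0 :=
    measure_eq_zero_iff_ae_notMem.2 (M.ae_νW_mem.mono fun w h hw => absurd h.1 (not_le.2 hw))
  rw [Gbar, this, ENNReal.toReal_zero]

lemma Gbar_le_of_forall_lt {t u : ℝ} (h : ∀ s < t, M.G s ≤ u) : M.Gbar t ≤ u := by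
  have hu : 0 ≤ u := (M.G_nonneg _).trans (h (t - 1) (by linarith))
  have h1 : M.νW (Set.Iio t) = ENNReal.ofReal (Function.leftLim (cdf M.νW) t - 0) := by
    rw [← StieltjesFunction.measure_Iio _ (tendsto_cdf_atBot M.νW), measure_cdf]
  rw [Gbar, h1, sub_zero]
  refine ENNReal.toReal_le_of_le_ofReal hu (ENNReal.ofReal_le_ofReal ?_)
  rw [(monotone_cdf M.νW).leftLim_eq_sSup]
  refine csSup_le ((Set.nonempty_Iio).image _) ?_
  rintro _ ⟨s, hs, rfl⟩
  rw [← G_eq_cdf]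
  exact h s hs

lemma G_eq_Gbar_add_atom (t : ℝ) : M.G t = M.Gbar t + M.atom t := by
  rw [G, Gbar, atom, ← ENNReal.toReal_add (measure_ne_top _ _) (measure_ne_top _ _),
    ← measure_union (by simp) (measurableSet_singleton t), Set.Iio_union_right]

lemma Ginv_of_nonpos {u : ℝ} (hu : u ≤ 0) : M.Ginv u = 0 := by
  have : {t | u ≤ M.G t} = Set.univ := Set.eq_univ_of_forall fun t => hu.trans (M.G_nonneg t)
  rw [Ginv, this, Real.sInf_univ]

lemma Ginv_of_one_lt {u : ℝ} (hu : 1 < u) : M.Ginv u = 0 := by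
  have : {t | u ≤ M.G t} = ∅ :=
    Set.eq_empty_of_forall_notMem fun t ht => absurd (hu.trans_le ht) (not_lt.2 (M.G_le_one t))
  rw [Ginv, this, Real.sInf_empty]

lemma zero_mem_lowerBounds {u : ℝ} (hu : 0 < u) : 0 ∈ lowerBounds {t | u ≤ M.G t} := by
  intro t ht
  by_contra! h
  have h2 : u ≤ M.G t := ht
  rw [M.G_of_neg h] at h2
  linarith

lemma le_G_of_Ginv_le {u t : ℝ} (hu : u ∈ Set.Ioc (0 : ℝ) 1) (h : M.Ginv u ≤ t) : u ≤ M.G t := by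
  have h1 : u ≤ M.G (M.Ginv u) := by
    have hc : Tendsto M.G (nhdsWithin (M.Ginv u) (Set.Ioi (M.Ginv u)))
        (nhds (M.G (M.Ginv u))) := by
      have e : M.G = cdf M.νW := funext M.G_eq_cdf
      rw [e]
      exact ((cdf M.νW).right_continuous _).mono Set.Ioi_subset_Ici_self
    refine ge_of_tendsto hc ?_
    filter_upwards [self_mem_nhdsWithin] with s hs
    obtain ⟨r, hr, hrs⟩ := exists_lt_of_csInf_lt
      (⟨1, by rw [Set.mem_ofPred_eq, M.G_of_one_le le_rfl]; exact hu.2⟩ :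
        {t | u ≤ M.G t}.Nonempty) hs
    exact le_trans hr (M.G_mono hrs.le)
  exact h1.trans (M.G_mono h)

lemma Ginv_le_of_le_G {u t : ℝ} (hu : 0 < u) (h : u ≤ M.G t) : M.Ginv u ≤ t :=
  csInf_le ⟨0, M.zero_mem_lowerBounds hu⟩ h

lemma measurable_Ginv : Measurable M.Ginv := by
  refine measurable_of_Iic fun t => ?_
  have : M.Ginv ⁻¹' Set.Iic t = (Set.Ioc 0 1 ∩ Set.Iic (M.G t)) ∪
      ((Set.Ioc (0 : ℝ) 1)ᶜ ∩ {_u | 0 ≤ t}) := by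
    ext u
    simp only [Set.mem_preimage, Set.mem_Iic, Set.mem_union, Set.mem_inter_iff, Set.mem_compl_iff,
      Set.mem_ofPred_eq]
    by_cases hu : u ∈ Set.Ioc (0 : ℝ) 1
    · simp only [hu, true_and, not_true_eq_false, false_and, or_false]
      exact ⟨M.le_G_of_Ginv_le hu, M.Ginv_le_of_le_G hu.1⟩
    · simp only [hu, false_and, not_false_eq_true, true_and, false_or]
      have : M.Ginv u = 0 := by
        rcases le_or_gt u 0 with h | h
        · exact M.Ginv_of_nonpos h
        · exact M.Ginv_of_one_lt (not_le.1 fun h1 => hu ⟨h, h1⟩)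
      rw [this]
  rw [this]
  exact (measurableSet_Ioc.inter measurableSet_Iic).union
    (measurableSet_Ioc.compl.inter (MeasurableSet.const _))

lemma Ginv_mem {u : ℝ} (hu : u ∈ Set.Icc (0 : ℝ) 1) : M.Ginv u ∈ Set.Icc (0 : ℝ) 1 := by
  rcases hu.1.eq_or_lt with rfl | h
  · rw [M.Ginv_of_nonpos le_rfl]
    simp
  · have h1 : u ≤ M.G 1 := by
      rw [M.G_of_one_le le_rfl]
      exact hu.2
    exact ⟨le_csInf ⟨1, h1⟩ (M.zero_mem_lowerBounds h), M.Ginv_le_of_le_G h h1⟩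

lemma Gbar_Ginv_le {u : ℝ} (hu : u ∈ Set.Icc (0 : ℝ) 1) : M.Gbar (M.Ginv u) ≤ u := by
  rcases hu.1.eq_or_lt with rfl | h
  · rw [M.Ginv_of_nonpos le_rfl, Gbar_zero]
  · exact M.Gbar_le_of_forall_lt fun s hs => by
      by_contra! h1
      exact absurd (M.Ginv_le_of_le_G h h1.le) (not_le.2 hs)

lemma le_G_Ginv {u : ℝ} (hu : u ∈ Set.Icc (0 : ℝ) 1) : u ≤ M.G (M.Ginv u) := by
  rcases hu.1.eq_or_lt with rfl | h
  · exact M.G_nonneg _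
  · exact M.le_G_of_Ginv_le ⟨h, hu.2⟩ le_rfl

lemma atom_nonneg (t : ℝ) : 0 ≤ M.atom t := ENNReal.toReal_nonneg

lemma pu_mul_atom {u : ℝ} (hu : u ∈ Set.Icc (0 : ℝ) 1) :
    M.pu u * M.atom (M.Ginv u) = u - M.Gbar (M.Ginv u) := by
  rcases eq_or_ne (M.atom (M.Ginv u)) 0 with h | h
  · have h1 := M.Gbar_Ginv_le hu
    have h2 := M.le_G_Ginv hu
    rw [G_eq_Gbar_add_atom] at h2
    rw [h] at h2 ⊢
    linarith
  · exact div_mul_cancel₀ _ h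

lemma pu_mem {u : ℝ} (hu : u ∈ Set.Icc (0 : ℝ) 1) : M.pu u ∈ Set.Icc (0 : ℝ) 1 := by
  have h1 := M.Gbar_Ginv_le hu
  have h2 := M.le_G_Ginv hu
  rw [G_eq_Gbar_add_atom] at h2
  exact ⟨div_nonneg (by linarith) (M.atom_nonneg _),
    div_le_one_of_le₀ (by linarith) (M.atom_nonneg _)⟩

lemma measurable_pu : Measurable M.pu := by
  have hG : Measurable M.G := M.G_mono.measurable
  have hB : Measurable M.Gbar := by
    refine Monotone.measurable fun s t h => ?_
    exact ENNReal.toReal_mono (measure_ne_top _ _) (measure_mono (Set.Iio_subset_Iio h))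
  have hA : M.atom = fun t => M.G t - M.Gbar t := funext fun t => by
    rw [G_eq_Gbar_add_atom]
    ring
  have hi := M.measurable_Ginv
  have hA' : Measurable M.atom := by
    rw [hA]
    exact hG.sub hB
  exact (measurable_id.sub (hB.comp hi)).div (hA'.comp hi)

/-- `thr u w` is the conditional probability that `S_u = 1` given `W = w`. -/
noncomputable def thr (u w : ℝ) : ℝ :=
  if w < M.Ginv u then 1 else if w = M.Ginv u then M.pu u else 0

lemma measurable_thr : Measurable fun p : ℝ × ℝ => M.thr p.1 p.2 := by
  have hi := M.measurable_Ginv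
  have hp := M.measurable_pu
  unfold thr
  refine Measurable.ite (measurableSet_lt measurable_snd (hi.comp measurable_fst)) measurable_const
    (Measurable.ite (measurableSet_eq_fun measurable_snd (hi.comp measurable_fst))
      (hp.comp measurable_fst) measurable_const)

lemma measurable_thr_right (u : ℝ) : Measurable (M.thr u) :=
  M.measurable_thr.comp measurable_prodMk_left

lemma thr_mem {u : ℝ} (hu : u ∈ Set.Icc (0 : ℝ) 1) (w : ℝ) : M.thr u w ∈ Set.Icc (0 : ℝ) 1 := by
  have h := M.pu_mem hu
  unfold thr
  split_ifs
  · simp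
  · exact h
  · simp

/-- `phi t = E[(t - W)⁺]`. -/
noncomputable def phi (t : ℝ) : ℝ := ∫ w, max (t - w) 0 ∂M.νW

/-- The mean of `W`. -/
noncomputable def meanW : ℝ := ∫ w, w ∂M.νW

/-- `low u = E[W S_u]`. -/
noncomputable def low (u : ℝ) : ℝ := ∫ w, M.thr u w * w ∂M.νW

lemma integrable_id_νW : Integrable (fun w : ℝ => w) M.νW :=
  Integrable.of_bound measurable_id.aestronglyMeasurable 1 (M.ae_νW_mem.mono fun w hw => by
    rw [Real.norm_eq_abs, abs_of_nonneg hw.1]; exact hw.2)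

lemma integrable_phi (t : ℝ) : Integrable (fun w : ℝ => max (t - w) 0) M.νW :=
  ((integrable_const t).sub M.integrable_id_νW).pos_part

lemma integrable_thr {u : ℝ} (hu : u ∈ Set.Icc (0 : ℝ) 1) : Integrable (M.thr u) M.νW :=
  Integrable.of_bound (M.measurable_thr_right u).aestronglyMeasurable 1 (ae_of_all _ fun w => by
    have h := M.thr_mem hu w
    rw [Real.norm_eq_abs, abs_of_nonneg h.1]; exact h.2)

lemma integrable_thr_mul {u : ℝ} (hu : u ∈ Set.Icc (0 : ℝ) 1) :
    Integrable (fun w => M.thr u w * w) M.νW :=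
  (M.integrable_thr hu).mul_bdd (c := 1) measurable_id.aestronglyMeasurable
    (M.ae_νW_mem.mono fun w hw => by
      rw [Real.norm_eq_abs, abs_of_nonneg hw.1]; exact hw.2)

lemma thr_eq_indicator (u : ℝ) : M.thr u = fun w =>
    (Set.Iio (M.Ginv u)).indicator 1 w + M.pu u * ({M.Ginv u} : Set ℝ).indicator 1 w := by
  funext w
  rcases lt_trichotomy w (M.Ginv u) with h | h | h
  · simp [thr, h, h.ne]
  · simp [thr, h]
  · simp [thr, h.not_gt, h.ne']

lemma integral_thr {u : ℝ} (hu : u ∈ Set.Icc (0 : ℝ) 1) : ∫ w, M.thr u w ∂M.νW = u := by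
  have h := M.pu_mul_atom hu
  rw [thr_eq_indicator, integral_add, integral_const_mul, integral_indicator_one measurableSet_Iio,
    integral_indicator_one (measurableSet_singleton _)]
  · change M.Gbar _ + M.pu u * M.atom _ = u
    linarith
  · exact (integrable_const (1 : ℝ)).indicator measurableSet_Iio
  · exact ((integrable_const (1 : ℝ)).indicator (measurableSet_singleton _)).const_mul _

lemma low_eq_num (u : ℝ) : M.low u = (∫ w in Set.Iio (M.Ginv u), w ∂M.νW) +
    M.pu u * (M.Ginv u * M.atom (M.Ginv u)) := by
  have e (w : ℝ) : M.thr u w * w = (Set.Iio (M.Ginv u)).indicator (fun w => w) w +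
      M.pu u * (M.Ginv u * ({M.Ginv u} : Set ℝ).indicator 1 w) := by
    rcases lt_trichotomy w (M.Ginv u) with h | h | h
    · simp [thr, h, h.ne]
    · simp [thr, h]
    · simp [thr, h.not_gt, h.ne']
  simp only [low, e]
  rw [integral_add, integral_const_mul, integral_const_mul, integral_indicator measurableSet_Iio,
    integral_indicator_one (measurableSet_singleton _)]
  · rfl
  · exact M.integrable_id_νW.indicator measurableSet_Iio
  · exact (((integrable_const (1 : ℝ)).indicator (measurableSet_singleton _)).const_mul _).const_mul _

lemma integral_one_sub_thr_mul {u : ℝ} (hu : u ∈ Set.Icc (0 : ℝ) 1) :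
    ∫ w, (1 - M.thr u w) * (1 - w) ∂M.νW = 1 - M.meanW - u + M.low u := by
  have e (w : ℝ) : (1 - M.thr u w) * (1 - w) = 1 - w - M.thr u w + M.thr u w * w := by ring
  simp only [e]
  have i1 := M.integrable_id_νW
  have i2 := M.integrable_thr hu
  have i3 := M.integrable_thr_mul hu
  have i0 : Integrable (fun _ : ℝ => (1 : ℝ)) M.νW := integrable_const 1
  have i4 : Integrable (fun w : ℝ => 1 - w) M.νW := i0.sub i1
  have i5 : Integrable (fun w : ℝ => 1 - w - M.thr u w) M.νW := i4.sub i2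
  rw [integral_add i5 i3, integral_sub i4 i2, integral_sub i0 i1, M.integral_thr hu]
  simp [meanW, low]

lemma b_num_eq {u : ℝ} (hu : u ∈ Set.Icc (0 : ℝ) 1) :
    (∫ w in Set.Ioi (M.Ginv u), (1 - w) ∂M.νW) +
      (1 - M.pu u) * ((1 - M.Ginv u) * M.atom (M.Ginv u)) = 1 - M.meanW - u + M.low u := by
  have e (w : ℝ) : (1 - M.thr u w) * (1 - w) = (Set.Ioi (M.Ginv u)).indicator (fun w => 1 - w) w +
      (1 - M.pu u) * ((1 - M.Ginv u) * ({M.Ginv u} : Set ℝ).indicator 1 w) := by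
    rcases lt_trichotomy w (M.Ginv u) with h | h | h
    · simp [thr, h, h.ne, h.not_gt]
    · simp [thr, h]
    · simp [thr, h.not_gt, h.ne', h]
  rw [← M.integral_one_sub_thr_mul hu]
  simp only [e]
  rw [integral_add, integral_const_mul, integral_const_mul, integral_indicator measurableSet_Ioi,
    integral_indicator_one (measurableSet_singleton _)]
  · rfl
  · exact ((integrable_const (1 : ℝ)).sub M.integrable_id_νW).indicator measurableSet_Ioi
  · exact (((integrable_const (1 : ℝ)).indicator (measurableSet_singleton _)).const_mul _).const_mul _

lemma low_eq {u : ℝ} (hu : u ∈ Set.Icc (0 : ℝ) 1) :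
    M.low u = u * M.Ginv u - M.phi (M.Ginv u) := by
  have e (w : ℝ) : M.thr u w * w = M.thr u w * M.Ginv u - max (M.Ginv u - w) 0 := by
    rcases lt_trichotomy w (M.Ginv u) with h | h | h
    · simp [thr, h, h.le]
    · simp [thr, h]
    · simp [thr, h.not_gt, h.ne', h.le]
  simp only [low, e]
  rw [integral_sub ((M.integrable_thr hu).mul_const _) (M.integrable_phi _), integral_mul_const,
    M.integral_thr hu, phi]

lemma le_low {u : ℝ} (hu : u ∈ Set.Icc (0 : ℝ) 1) (t : ℝ) : u * t - M.phi t ≤ M.low u := by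
  rw [← M.integral_thr hu, ← integral_mul_const, phi,
    ← integral_sub ((M.integrable_thr hu).mul_const _) (M.integrable_phi _), M.integral_thr hu]
  refine integral_mono (((M.integrable_thr hu).mul_const _).sub (M.integrable_phi _))
    (M.integrable_thr_mul hu) fun w => ?_
  have h := M.thr_mem hu w
  change M.thr u w * t - max (t - w) 0 ≤ M.thr u w * w
  nlinarith [h.1, h.2, le_max_left (t - w) 0, le_max_right (t - w) 0,
    mul_nonneg (sub_nonneg.2 h.2) (le_max_right (t - w) 0)]

lemma phi_one : M.phi 1 = 1 - M.meanW := by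
  have : M.phi 1 = ∫ w, (1 - w) ∂M.νW :=
    integral_congr_ae (M.ae_νW_mem.mono fun w hw => max_eq_left (sub_nonneg.2 hw.2))
  rw [this, integral_sub (integrable_const 1) M.integrable_id_νW]
  simp [meanW]

lemma phi_nonneg (t : ℝ) : 0 ≤ M.phi t := integral_nonneg fun _ => le_max_right _ _

lemma meanW_mem : M.meanW ∈ Set.Icc (0 : ℝ) 1 := by
  refine ⟨integral_nonneg_of_ae (M.ae_νW_mem.mono fun w hw => hw.1), ?_⟩
  have := M.phi_nonneg 1
  rw [phi_one] at this
  linarith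

lemma low_nonneg {u : ℝ} (hu : u ∈ Set.Icc (0 : ℝ) 1) : 0 ≤ M.low u :=
  integral_nonneg_of_ae (M.ae_νW_mem.mono fun w hw => mul_nonneg (M.thr_mem hu w).1 hw.1)

lemma low_le {u : ℝ} (hu : u ∈ Set.Icc (0 : ℝ) 1) : M.low u ≤ u := by
  refine le_trans ?_ (M.integral_thr hu).le
  exact integral_mono_ae (M.integrable_thr_mul hu) (M.integrable_thr hu)
    (M.ae_νW_mem.mono fun w hw => mul_le_of_le_one_right (M.thr_mem hu w).1 hw.2)

lemma low_one : M.low 1 = M.meanW := by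
  have h1 : (1 : ℝ) ∈ Set.Icc (0 : ℝ) 1 := by simp
  refine le_antisymm ?_ ?_
  · exact integral_mono_ae (M.integrable_thr_mul h1) M.integrable_id_νW
      (M.ae_νW_mem.mono fun w hw => mul_le_of_le_one_left hw.1 (M.thr_mem h1 w).2)
  · have := M.le_low h1 1
    rw [phi_one] at this
    linarith

lemma mul_a {u : ℝ} (hu : u ∈ Set.Icc (0 : ℝ) 1) : u * M.a u = M.low u := by
  unfold a
  split_ifs with h
  · subst h
    have := M.low_nonneg hu
    have := M.low_le hu
    linarith
  · rw [← low_eq_num, mul_div_cancel₀ _ h]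

lemma one_sub_mul_b {u : ℝ} (hu : u ∈ Set.Icc (0 : ℝ) 1) :
    (1 - u) * M.b u = 1 - M.meanW - u + M.low u := by
  unfold b
  split_ifs with h
  · subst h
    rw [low_one]
    ring
  · rw [M.b_num_eq hu, mul_div_cancel₀ _ (sub_ne_zero.2 (Ne.symm h))]

lemma a_zero : M.a 0 = 0 := if_pos rfl

lemma b_one : M.b 1 = 0 := if_pos rfl

lemma a_one : M.a 1 = M.meanW := by
  rw [← low_one, ← M.mul_a (by simp), one_mul]

lemma b_zero : M.b 0 = 1 - M.meanW := by
  have h := M.one_sub_mul_b (u := 0) (by simp)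
  have h1 := M.mul_a (u := 0) (by simp)
  linarith

lemma a_mem {u : ℝ} (hu : u ∈ Set.Icc (0 : ℝ) 1) : M.a u ∈ Set.Icc (0 : ℝ) 1 := by
  rcases hu.1.eq_or_lt with rfl | h
  · simp [a_zero]
  · have e := M.mul_a hu
    have h1 := M.low_nonneg hu
    have h2 := M.low_le hu
    constructor <;> nlinarith

lemma b_mem {u : ℝ} (hu : u ∈ Set.Icc (0 : ℝ) 1) : M.b u ∈ Set.Icc (0 : ℝ) 1 := by
  rcases hu.2.eq_or_lt with rfl | h
  · simp [b_one]
  · have e := M.one_sub_mul_b hu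
    have h1 := M.le_low hu 1
    rw [phi_one] at h1
    have h2 : M.low u ≤ M.meanW :=
      integral_mono_ae (M.integrable_thr_mul hu) M.integrable_id_νW
        (M.ae_νW_mem.mono fun w hw => mul_le_of_le_one_left hw.1 (M.thr_mem hu w).2)
    constructor <;> nlinarith

lemma continuous_phi : Continuous M.phi := by
  have : LipschitzWith 1 M.phi := LipschitzWith.of_dist_le_mul fun s t => by
    rw [Real.dist_eq, phi, phi, ← integral_sub (M.integrable_phi s) (M.integrable_phi t),
      NNReal.coe_one, one_mul, Real.dist_eq]
    refine (abs_integral_le_integral_abs).trans ?_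
    calc ∫ w, |max (s - w) 0 - max (t - w) 0| ∂M.νW ≤ ∫ _w, |s - t| ∂M.νW := by
          refine integral_mono ((M.integrable_phi s).sub (M.integrable_phi t)).abs
            (integrable_const _) fun w => ?_
          refine (abs_max_sub_max_le_abs _ _ _).trans (le_of_eq ?_)
          ring_nf
      _ = |s - t| := by simp
  exact this.continuous

lemma aestronglyMeasurable_low {ρ : Measure ℝ} (hρ : ∀ᵐ u ∂ρ, u ∈ Set.Icc (0 : ℝ) 1) :
    AEStronglyMeasurable M.low ρ := by
  have : Measurable fun u => u * M.Ginv u - M.phi (M.Ginv u) :=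
    (measurable_id.mul M.measurable_Ginv).sub (M.continuous_phi.measurable.comp M.measurable_Ginv)
  exact this.aestronglyMeasurable.congr (hρ.mono fun u hu => (M.low_eq hu).symm)

lemma integrable_a {ρ : Measure ℝ} [IsFiniteMeasure ρ] (hρ : ∀ᵐ u ∂ρ, u ∈ Set.Icc (0 : ℝ) 1) :
    Integrable M.a ρ := by
  refine Integrable.of_bound (C := 1) ?_ (hρ.mono fun u hu => by
    have h := M.a_mem hu
    rw [Real.norm_eq_abs, abs_of_nonneg h.1]; exact h.2)
  have h1 : AEStronglyMeasurable (fun u => M.low u / u) ρ :=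
    (M.aestronglyMeasurable_low hρ).aemeasurable.div aemeasurable_id |>.aestronglyMeasurable
  refine h1.congr (hρ.mono fun u hu => ?_)
  rcases eq_or_ne u 0 with rfl | h
  · simp [a_zero]
  · simp only [← M.mul_a hu]
    field_simp

lemma integrable_b {ρ : Measure ℝ} [IsFiniteMeasure ρ] (hρ : ∀ᵐ u ∂ρ, u ∈ Set.Icc (0 : ℝ) 1) :
    Integrable M.b ρ := by
  refine Integrable.of_bound (C := 1) ?_ (hρ.mono fun u hu => by
    have h := M.b_mem hu
    rw [Real.norm_eq_abs, abs_of_nonneg h.1]; exact h.2)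
  have h1 : AEStronglyMeasurable (fun u => (1 - M.meanW - u + M.low u) / (1 - u)) ρ :=
    ((aemeasurable_const.sub aemeasurable_id).add
      (M.aestronglyMeasurable_low hρ).aemeasurable).div
      (aemeasurable_const.sub aemeasurable_id) |>.aestronglyMeasurable
  refine h1.congr (hρ.mono fun u hu => ?_)
  rcases eq_or_ne u 1 with rfl | h
  · simp [b_one]
  · have : 1 - u ≠ 0 := sub_ne_zero.2 h.symm
    simp only [← M.one_sub_mul_b hu]
    field_simp

end Model

section Weights

variable {n : ℕ}

/-- The weight of the `i`-th hypothesis in the false discovery proportion. -/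
noncomputable def rejWeight (d : Fin n → Bool) (i : Fin n) : ℝ :=
  (if d i then 1 else 0) / max 1 (nRej d)

/-- The weight of the `i`-th hypothesis in the false non-discovery proportion. -/
noncomputable def accWeight (d : Fin n → Bool) (i : Fin n) : ℝ :=
  (if d i then 0 else 1) / max 1 (nAcc d)

lemma FDP_eq_sum (θ d : Fin n → Bool) :
    FDP θ d = ∑ i, rejWeight d i * (if θ i then 0 else 1) := by
  rw [FDP, nFD, Finset.sum_div]
  exact Finset.sum_congr rfl fun i _ => by rw [rejWeight, div_mul_eq_mul_div]

lemma FNP_eq_sum (θ d : Fin n → Bool) :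
    FNP θ d = ∑ i, accWeight d i * (if θ i then 1 else 0) := by
  rw [FNP, nFN, Finset.sum_div]
  exact Finset.sum_congr rfl fun i _ => by rw [accWeight, div_mul_eq_mul_div]

lemma rejWeight_mem (d : Fin n → Bool) (i : Fin n) : rejWeight d i ∈ Set.Icc (0 : ℝ) 1 := by
  have h := le_max_left 1 (nRej d)
  unfold rejWeight
  split_ifs
  · exact ⟨by positivity, div_le_one_of_le₀ h (by positivity)⟩
  · simp

lemma accWeight_mem (d : Fin n → Bool) (i : Fin n) : accWeight d i ∈ Set.Icc (0 : ℝ) 1 := by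
  have h := le_max_left 1 (nAcc d)
  unfold accWeight
  split_ifs
  · simp
  · exact ⟨by positivity, div_le_one_of_le₀ h (by positivity)⟩

lemma sum_rejWeight_le (d : Fin n → Bool) : ∑ i, rejWeight d i ≤ 1 := by
  simp only [rejWeight, ← Finset.sum_div]
  exact div_le_one_of_le₀ (le_max_right _ _) (by positivity)

lemma sum_accWeight_le (d : Fin n → Bool) : ∑ i, accWeight d i ≤ 1 := by
  simp only [accWeight, ← Finset.sum_div]
  exact div_le_one_of_le₀ (le_max_right _ _) (by positivity)

end Weights

namespace IsRule

variable {𝒳 : Type*} [MeasurableSpace 𝒳] {n : ℕ} {κ : (Fin n → 𝒳) → Measure (Fin n → Bool)}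

lemma measurable_real (hκ : IsRule κ) (d : Fin n → Bool) : Measurable fun x => (κ x).real {d} :=
  ((Measure.measurable_coe (measurableSet_singleton d)).comp hκ.1).ennreal_toReal

lemma real_le_one (hκ : IsRule κ) (x : Fin n → 𝒳) (d : Fin n → Bool) : (κ x).real {d} ≤ 1 := by
  have := hκ.2 x
  exact measureReal_le_one

lemma integral_eq_sum (hκ : IsRule κ) (x : Fin n → 𝒳) (F : (Fin n → Bool) → ℝ) :
    ∫ d, F d ∂κ x = ∑ d, (κ x).real {d} * F d := by
  have := hκ.2 x
  rw [integral_fintype Integrable.of_finite]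
  rfl

end IsRule

namespace Model

variable {𝒳 : Type*} [MeasurableSpace 𝒳] (M : Model 𝒳) {n : ℕ}
  {κ : (Fin n → 𝒳) → Measure (Fin n → Bool)}

lemma integrable_rule_mul (hκ : IsRule κ) (d : Fin n → Bool) {h : (Fin n → Bool × 𝒳) → ℝ}
    (hm : Measurable h) (C : ℝ) (hb : ∀ ω, |h ω| ≤ C) :
    Integrable (fun ω => (κ fun i => (ω i).2).real {d} * h ω) (M.jointN n) := by
  refine Integrable.of_bound (C := C)
    (((hκ.measurable_real d).comp (measurable_snd_pi n)).mul hm).aestronglyMeasurable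
    (ae_of_all _ fun ω => ?_)
  rw [norm_mul, Real.norm_eq_abs, Real.norm_eq_abs, abs_of_nonneg measureReal_nonneg]
  exact (mul_le_of_le_one_left (abs_nonneg _) (hκ.real_le_one _ d)).trans (hb ω)

lemma measurable_label (i : Fin n) (p q : ℝ) :
    Measurable fun ω : Fin n → Bool × 𝒳 => if (ω i).1 then p else q :=
  (measurable_from_top (f := fun b : Bool => if b then p else q)).comp
    (measurable_fst.comp (measurable_pi_apply i))

lemma measurable_Lfdr_eval (i : Fin n) : Measurable fun ω : Fin n → Bool × 𝒳 => M.Lfdr (ω i).2 :=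
  M.measurable_Lfdr_snd.comp (measurable_pi_apply i)

lemma FDR_eq_sum (hκ : IsRule κ) : M.FDR n κ = ∑ d, ∑ i, rejWeight d i *
    ∫ ω, (κ fun i => (ω i).2).real {d} * M.Lfdr (ω i).2 ∂M.jointN n := by
  have hi (d : Fin n → Bool) (i : Fin n) : Integrable (fun ω : Fin n → Bool × 𝒳 =>
      rejWeight d i * ((κ fun i => (ω i).2).real {d} * (if (ω i).1 then 0 else 1)))
      (M.jointN n) :=
    (M.integrable_rule_mul hκ d (measurable_label i 0 1) 1
      fun ω => by split_ifs <;> norm_num).const_mul _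
  have e (ω : Fin n → Bool × 𝒳) : ∫ d, FDP (fun i => (ω i).1) d ∂(κ fun i => (ω i).2) =
      ∑ d, ∑ i, rejWeight d i *
        ((κ fun i => (ω i).2).real {d} * (if (ω i).1 then 0 else 1)) := by
    rw [hκ.integral_eq_sum]
    refine Finset.sum_congr rfl fun d _ => ?_
    rw [FDP_eq_sum, Finset.mul_sum]
    exact Finset.sum_congr rfl fun i _ => by ring
  simp only [FDR, e]
  rw [integral_finsetSum _ fun d _ => integrable_finsetSum _ fun i _ => hi d i]
  refine Finset.sum_congr rfl fun d _ => ?_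
  rw [integral_finsetSum _ fun i _ => hi d i]
  refine Finset.sum_congr rfl fun i _ => ?_
  rw [integral_const_mul, M.integral_null (hκ.measurable_real d) fun x => measureReal_nonneg]

lemma FNR_eq_sum (hκ : IsRule κ) : M.FNR n κ = ∑ d, ∑ i, accWeight d i *
    ∫ ω, (κ fun i => (ω i).2).real {d} * (1 - M.Lfdr (ω i).2) ∂M.jointN n := by
  have hi (d : Fin n → Bool) (i : Fin n) : Integrable (fun ω : Fin n → Bool × 𝒳 =>
      accWeight d i * ((κ fun i => (ω i).2).real {d} * (if (ω i).1 then 1 else 0)))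
      (M.jointN n) :=
    (M.integrable_rule_mul hκ d (measurable_label i 1 0) 1
      fun ω => by split_ifs <;> norm_num).const_mul _
  have e (ω : Fin n → Bool × 𝒳) : ∫ d, FNP (fun i => (ω i).1) d ∂(κ fun i => (ω i).2) =
      ∑ d, ∑ i, accWeight d i *
        ((κ fun i => (ω i).2).real {d} * (if (ω i).1 then 1 else 0)) := by
    rw [hκ.integral_eq_sum]
    refine Finset.sum_congr rfl fun d _ => ?_
    rw [FNP_eq_sum, Finset.mul_sum]
    exact Finset.sum_congr rfl fun i _ => by ring
  simp only [FNR, e]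
  rw [integral_finsetSum _ fun d _ => integrable_finsetSum _ fun i _ => hi d i]
  refine Finset.sum_congr rfl fun d _ => ?_
  rw [integral_finsetSum _ fun i _ => hi d i]
  refine Finset.sum_congr rfl fun i _ => ?_
  rw [integral_const_mul, M.integral_nonnull (hκ.measurable_real d) (fun x => measureReal_nonneg)
    fun x => hκ.real_le_one x d]

lemma FNR_nonneg (hκ : IsRule κ) : 0 ≤ M.FNR n κ := by
  rw [M.FNR_eq_sum hκ]
  exact Finset.sum_nonneg fun d _ => Finset.sum_nonneg fun i _ =>
    mul_nonneg (accWeight_mem d i).1 (integral_nonneg fun ω =>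
      mul_nonneg measureReal_nonneg (sub_nonneg.2 (M.Lfdr_le_one _)))

lemma bddBelow_FNR (α : ℝ) : BddBelow {r | ∃ κ : (Fin n → 𝒳) → Measure (Fin n → Bool),
    IsRule κ ∧ M.FDR n κ ≤ α ∧ r = M.FNR n κ} :=
  ⟨0, by rintro _ ⟨κ, hκ, -, rfl⟩; exact M.FNR_nonneg hκ⟩

/-- Conditional probability of the decision `s` given `W = w` when thresholding at level `u`. -/
noncomputable def dec (u : ℝ) (s : Bool) (w : ℝ) : ℝ := if s then M.thr u w else 1 - M.thr u w

/-- Probability of the decision `s` when thresholding at level `u`. -/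
noncomputable def decProb (u : ℝ) (s : Bool) : ℝ := if s then u else 1 - u

lemma measurable_dec (s : Bool) : Measurable fun p : ℝ × ℝ => M.dec p.1 s p.2 := by
  cases s
  · exact measurable_const.sub M.measurable_thr
  · simpa [dec] using M.measurable_thr

lemma dec_mem {u : ℝ} (hu : u ∈ Set.Icc (0 : ℝ) 1) (s : Bool) (w : ℝ) :
    M.dec u s w ∈ Set.Icc (0 : ℝ) 1 := by
  have h := M.thr_mem hu w
  cases s
  · simp only [dec, Bool.false_eq_true, if_false]
    exact ⟨by linarith [h.2], by linarith [h.1]⟩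
  · simpa [dec] using h

lemma integral_dec {u : ℝ} (hu : u ∈ Set.Icc (0 : ℝ) 1) (s : Bool) :
    ∫ w, M.dec u s w ∂M.νW = decProb u s := by
  cases s
  · simp only [dec, decProb, Bool.false_eq_true, if_false]
    rw [integral_sub (integrable_const 1) (M.integrable_thr hu), M.integral_thr hu]
    simp
  · simpa [dec, decProb] using M.integral_thr hu

lemma decProb_nonneg {u : ℝ} (hu : u ∈ Set.Icc (0 : ℝ) 1) (s : Bool) : 0 ≤ decProb u s := by
  cases s
  · simpa [decProb] using hu.2
  · simpa [decProb] using hu.1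

lemma sum_prod_bool (F : Fin n → Bool → ℝ) (hF : ∀ i, F i true + F i false = 1) :
    ∑ d : Fin n → Bool, ∏ i, F i (d i) = 1 := by
  rw [← Fintype.piFinset_univ, ← Finset.prod_univ_sum]
  simp [hF]

/-- The probability of the decision vector `d` when thresholding at a random level `U ∼ ρ`. -/
noncomputable def mixWeight (ρ : Measure ℝ) (d : Fin n → Bool) (x : Fin n → 𝒳) : ℝ :=
  ∫ u, ∏ j, M.dec u (d j) (M.Lfdr (x j)) ∂ρ

/-- The rule thresholding at a random level `U ∼ ρ`. -/
noncomputable def mixRule (n : ℕ) (ρ : Measure ℝ) (x : Fin n → 𝒳) : Measure (Fin n → Bool) :=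
  ∑ d, ENNReal.ofReal (M.mixWeight ρ d x) • Measure.dirac d

variable {ρ : Measure ℝ}

lemma prod_dec_mem {u : ℝ} (hu : u ∈ Set.Icc (0 : ℝ) 1) (d : Fin n → Bool) (x : Fin n → 𝒳) :
    ∏ j, M.dec u (d j) (M.Lfdr (x j)) ∈ Set.Icc (0 : ℝ) 1 :=
  ⟨Finset.prod_nonneg fun _ _ => (M.dec_mem hu _ _).1,
    Finset.prod_le_one (fun _ _ => (M.dec_mem hu _ _).1) fun _ _ => (M.dec_mem hu _ _).2⟩

lemma measurable_prod_dec (d : Fin n → Bool) :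
    Measurable fun p : (Fin n → 𝒳) × ℝ => ∏ j, M.dec p.2 (d j) (M.Lfdr (p.1 j)) := by
  refine Finset.measurable_prod _ fun j _ => (M.measurable_dec (d j)).comp
    (measurable_snd.prodMk (M.measurable_Lfdr.comp ((measurable_pi_apply j).comp measurable_fst)))

lemma mixWeight_nonneg (hρ : ∀ᵐ u ∂ρ, u ∈ Set.Icc (0 : ℝ) 1) (d : Fin n → Bool) (x : Fin n → 𝒳) :
    0 ≤ M.mixWeight ρ d x :=
  integral_nonneg_of_ae (hρ.mono fun _ hu => (M.prod_dec_mem hu d x).1)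

lemma measurable_mixWeight [SFinite ρ] (d : Fin n → Bool) :
    Measurable (M.mixWeight ρ d) :=
  ((M.measurable_prod_dec d).stronglyMeasurable.integral_prod_right').measurable

lemma sum_mixWeight [IsProbabilityMeasure ρ] (hρ : ∀ᵐ u ∂ρ, u ∈ Set.Icc (0 : ℝ) 1)
    (x : Fin n → 𝒳) : ∑ d, M.mixWeight ρ d x = 1 := by
  simp only [mixWeight]
  rw [← integral_finsetSum]
  · have e (u : ℝ) : ∑ d : Fin n → Bool, ∏ j, M.dec u (d j) (M.Lfdr (x j)) = 1 :=
      sum_prod_bool (fun j s => M.dec u s (M.Lfdr (x j))) fun j => by simp [dec]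
    simp [e]
  · exact fun d _ => Integrable.of_bound (C := 1)
      ((M.measurable_prod_dec d).comp measurable_prodMk_left).aestronglyMeasurable
      (hρ.mono fun u hu => by
        have h := M.prod_dec_mem hu d x
        rw [Real.norm_eq_abs, abs_of_nonneg h.1]; exact h.2)

lemma mixRule_real (hρ : ∀ᵐ u ∂ρ, u ∈ Set.Icc (0 : ℝ) 1) (x : Fin n → 𝒳) (d : Fin n → Bool) :
    (M.mixRule n ρ x).real {d} = M.mixWeight ρ d x := by
  rw [Measure.real, mixRule, Measure.finsetSum_apply, Finset.sum_eq_single d]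
  · simp [M.mixWeight_nonneg hρ]
  · intro d' _ h
    simp [h]
  · simp

lemma isRule_mixRule [IsProbabilityMeasure ρ] (hρ : ∀ᵐ u ∂ρ, u ∈ Set.Icc (0 : ℝ) 1) :
    IsRule (M.mixRule n ρ) := by
  refine ⟨Measure.measurable_of_measurable_coe _ fun s hs => ?_, fun x => ⟨?_⟩⟩
  · simp only [mixRule, Measure.finsetSum_apply, Measure.smul_apply, smul_eq_mul]
    exact Finset.measurable_sum _ fun d _ => (M.measurable_mixWeight d).ennreal_ofReal.mul_const _
  · simp only [mixRule, Measure.finsetSum_apply, Measure.smul_apply, smul_eq_mul, measure_univ,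
      mul_one]
    rw [← ENNReal.ofReal_sum_of_nonneg fun d _ => M.mixWeight_nonneg hρ d x, M.sum_mixWeight hρ,
      ENNReal.ofReal_one]

lemma integral_mixRule [IsProbabilityMeasure ρ] (hρ : ∀ᵐ u ∂ρ, u ∈ Set.Icc (0 : ℝ) 1)
    {v r : ℝ → ℝ} (hv : Measurable v) (hv1 : ∀ w ∈ Set.Icc (0 : ℝ) 1, |v w| ≤ 1)
    (d : Fin n → Bool) (i : Fin n)
    (hr : ∀ u ∈ Set.Icc (0 : ℝ) 1, ∫ w, M.dec u (d i) w * v w ∂M.νW = decProb u (d i) * r u) :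
    ∫ ω, (M.mixRule n ρ fun i => (ω i).2).real {d} * v (M.Lfdr (ω i).2) ∂M.jointN n =
      ∫ u, (∏ j, decProb u (d j)) * r u ∂ρ := by
  have hm : Measurable fun p : (Fin n → Bool × 𝒳) × ℝ =>
      (∏ j, M.dec p.2 (d j) (M.Lfdr (p.1 j).2)) * v (M.Lfdr (p.1 i).2) :=
    ((M.measurable_prod_dec d).comp (((measurable_snd_pi n).comp measurable_fst).prodMk
      measurable_snd)).mul (hv.comp ((M.measurable_Lfdr_eval i).comp measurable_fst))
  simp only [M.mixRule_real hρ, mixWeight, ← integral_mul_const]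
  rw [integral_integral_swap]
  · refine integral_congr_ae (hρ.mono fun u hu => ?_)
    have hd (s : Bool) : Measurable (M.dec u s) := (M.measurable_dec s).comp measurable_prodMk_left
    have e (ω : Fin n → Bool × 𝒳) :
        (∏ j, M.dec u (d j) (M.Lfdr (ω j).2)) * v (M.Lfdr (ω i).2) =
        ∏ j, (M.dec u (d j) (M.Lfdr (ω j).2) * if j = i then v (M.Lfdr (ω j).2) else 1) := by
      rw [Finset.prod_mul_distrib]
      simp
    have e2 (j : Fin n) : ∫ y, M.dec u (d j) (M.Lfdr y.2) *
        (if j = i then v (M.Lfdr y.2) else 1) ∂M.joint =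
        decProb u (d j) * if j = i then r u else 1 := by
      by_cases h : j = i
      · subst h
        simp only [if_true]
        rw [← hr u hu]
        exact M.integral_comp_Lfdr (h := fun w => M.dec u (d j) w * v w) ((hd _).mul hv)
      · simp only [h, if_false, mul_one]
        rw [M.integral_comp_Lfdr (hd _), M.integral_dec hu]
    simp only [e, jointN]
    rw [integral_fintype_prod_eq_prod (fun (j : Fin n) (y : Bool × 𝒳) =>
      M.dec u (d j) (M.Lfdr y.2) * if j = i then v (M.Lfdr y.2) else 1)]
    simp only [e2]
    rw [Finset.prod_mul_distrib]
    simp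
  · refine Integrable.of_bound (C := 1) hm.aestronglyMeasurable ?_
    have := (Measure.quasiMeasurePreserving_snd (μ := M.jointN n) (ν := ρ)).ae hρ
    refine this.mono fun p hp => ?_
    have h := M.prod_dec_mem hp d fun j => (p.1 j).2
    rw [Function.uncurry, norm_mul, Real.norm_eq_abs, Real.norm_eq_abs, abs_of_nonneg h.1]
    exact mul_le_one₀ h.2 (abs_nonneg _) (hv1 _ ⟨M.Lfdr_nonneg _, M.Lfdr_le_one _⟩)

lemma sum_weight_mul_integral_le [IsProbabilityMeasure ρ] (hρ : ∀ᵐ u ∂ρ, u ∈ Set.Icc (0 : ℝ) 1)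
    {r : ℝ → ℝ} (hr : Integrable r ρ) (hr0 : ∀ u ∈ Set.Icc (0 : ℝ) 1, 0 ≤ r u)
    (c : (Fin n → Bool) → Fin n → ℝ) (hc : ∀ d, ∑ i, c d i ≤ 1) :
    ∑ d, ∑ i, c d i * ∫ u, (∏ j, decProb u (d j)) * r u ∂ρ ≤ ∫ u, r u ∂ρ := by
  have hm (d : Fin n → Bool) : Measurable fun u => ∏ j, decProb u (d j) :=
    Finset.measurable_prod _ fun j _ => by
      unfold decProb
      split_ifs
      · exact measurable_id
      · exact measurable_const.sub measurable_id
  have h0 (d : Fin n → Bool) {u : ℝ} (hu : u ∈ Set.Icc (0 : ℝ) 1) : 0 ≤ ∏ j, decProb u (d j) :=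
    Finset.prod_nonneg fun j _ => decProb_nonneg hu _
  have hs (u : ℝ) : ∑ d : Fin n → Bool, ∏ j, decProb u (d j) = 1 :=
    sum_prod_bool (fun _ s => decProb u s) fun j => by simp [decProb]
  have hi (d : Fin n → Bool) : Integrable (fun u => (∏ j, decProb u (d j)) * r u) ρ :=
    hr.bdd_mul (c := 1) (hm d).aestronglyMeasurable (hρ.mono fun u hu => by
      rw [Real.norm_eq_abs, abs_of_nonneg (h0 d hu), ← hs u]
      exact Finset.single_le_sum (f := fun d : Fin n → Bool => ∏ j, decProb u (d j))
        (fun d _ => h0 d hu) (Finset.mem_univ d))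
  calc ∑ d, ∑ i, c d i * ∫ u, (∏ j, decProb u (d j)) * r u ∂ρ
      ≤ ∑ d : Fin n → Bool, ∫ u, (∏ j, decProb u (d j)) * r u ∂ρ := by
        refine Finset.sum_le_sum fun d _ => ?_
        rw [← Finset.sum_mul]
        exact mul_le_of_le_one_left (integral_nonneg_of_ae (hρ.mono fun u hu =>
          mul_nonneg (h0 d hu) (hr0 u hu))) (hc d)
    _ = ∫ u, r u ∂ρ := by
        rw [← integral_finsetSum _ fun d _ => hi d]
        simp only [← Finset.sum_mul, hs, one_mul]

lemma FDR_mixRule_le [IsProbabilityMeasure ρ] (hρ : ∀ᵐ u ∂ρ, u ∈ Set.Icc (0 : ℝ) 1) :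
    M.FDR n (M.mixRule n ρ) ≤ ∫ u, M.a u ∂ρ := by
  rw [M.FDR_eq_sum (M.isRule_mixRule hρ)]
  refine le_trans (Finset.sum_le_sum fun d _ => Finset.sum_le_sum fun i _ => le_of_eq ?_)
    (sum_weight_mul_integral_le hρ (M.integrable_a hρ) (fun u hu => (M.a_mem hu).1) rejWeight
      sum_rejWeight_le)
  by_cases h : d i
  · rw [M.integral_mixRule hρ (v := fun w => w) (r := M.a) measurable_id
      (fun w hw => by rw [abs_of_nonneg hw.1]; exact hw.2)]
    intro u hu
    simp only [h, dec, decProb, if_true, M.mul_a hu, low]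
  · simp [rejWeight, h]

lemma FNR_mixRule_le [IsProbabilityMeasure ρ] (hρ : ∀ᵐ u ∂ρ, u ∈ Set.Icc (0 : ℝ) 1) :
    M.FNR n (M.mixRule n ρ) ≤ ∫ u, M.b u ∂ρ := by
  rw [M.FNR_eq_sum (M.isRule_mixRule hρ)]
  refine le_trans (Finset.sum_le_sum fun d _ => Finset.sum_le_sum fun i _ => le_of_eq ?_)
    (sum_weight_mul_integral_le hρ (M.integrable_b hρ) (fun u hu => (M.b_mem hu).1) accWeight
      sum_accWeight_le)
  by_cases h : d i
  · simp [accWeight, h]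
  · rw [M.integral_mixRule hρ (v := fun w => 1 - w) (r := M.b) (measurable_const.sub measurable_id)
      (fun w hw => by rw [abs_of_nonneg (sub_nonneg.2 hw.2)]; linarith [hw.1])]
    intro u hu
    simp only [h, dec, decProb, Bool.false_eq_true, if_false, M.one_sub_mul_b hu,
      M.integral_one_sub_thr_mul hu]

lemma bstarstar_nonempty {α : ℝ} (hα : 0 ≤ α) : {y | ∃ ρ : Measure ℝ, IsProbabilityMeasure ρ ∧
    (∀ᵐ u ∂ρ, u ∈ Set.Icc (0 : ℝ) 1) ∧ (∫ u, M.a u ∂ρ) ≤ α ∧ y = ∫ u, M.b u ∂ρ}.Nonempty :=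
  ⟨_, Measure.dirac 0, inferInstance, by simp [ae_dirac_eq], by simpa [a_zero] using hα, rfl⟩

lemma bstarstar_le {α : ℝ} [IsProbabilityMeasure ρ] (hρ : ∀ᵐ u ∂ρ, u ∈ Set.Icc (0 : ℝ) 1)
    (ha : ∫ u, M.a u ∂ρ ≤ α) : M.bstarstar α ≤ ∫ u, M.b u ∂ρ := by
  refine csInf_le ⟨0, ?_⟩ ⟨ρ, inferInstance, hρ, ha, rfl⟩
  rintro _ ⟨ρ', h1, h2, -, rfl⟩
  exact integral_nonneg_of_ae (h2.mono fun u hu => (M.b_mem hu).1)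

lemma FNRstar_le_bstarstar (n : ℕ) {α : ℝ} (hα : 0 ≤ α) : M.FNRstar n α ≤ M.bstarstar α := by
  refine le_csInf (M.bstarstar_nonempty hα) ?_
  rintro _ ⟨ρ, h1, hρ, ha, rfl⟩
  exact (csInf_le (M.bddBelow_FNR α)
    ⟨M.mixRule n ρ, M.isRule_mixRule hρ, (M.FDR_mixRule_le hρ).trans ha, rfl⟩).trans
    (M.FNR_mixRule_le hρ)

end Model

/-- The distance between the empirical and the population values of `E[(t - W)⁺]`, summed over
the grid `t = j / m`, plus the mesh of the grid. -/
noncomputable def Model.gridDev {𝒳 : Type*} [MeasurableSpace 𝒳] (M : Model 𝒳) (m : ℕ) {n : ℕ}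
    (w : Fin n → ℝ) : ℝ :=
  1 / m + ∑ j ∈ Finset.range (m + 1), |(∑ i, max ((j : ℝ) / m - w i) 0) / n - M.phi (j / m)|

/-- The proportion of rejections, moved to the endpoints `0` and `1` when it is within `η`
of them. -/
noncomputable def level (η : ℝ) {n : ℕ} (d : Fin n → Bool) : ℝ :=
  if nRej d / n < η then 0 else if 1 - η < nRej d / n then 1 else nRej d / n

lemma nRej_nonneg {n : ℕ} (d : Fin n → Bool) : 0 ≤ nRej d :=
  Finset.sum_nonneg fun i _ => by split_ifs <;> norm_num

lemma nRej_add_nAcc {n : ℕ} (d : Fin n → Bool) : nRej d + nAcc d = n := by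
  rw [nRej, nAcc, ← Finset.sum_add_distrib]
  have e (i : Fin n) : ((if d i then (1 : ℝ) else 0) + if d i then 0 else 1) = 1 := by
    split_ifs <;> norm_num
  simp [e]

lemma nAcc_nonneg {n : ℕ} (d : Fin n → Bool) : 0 ≤ nAcc d :=
  Finset.sum_nonneg fun i _ => by split_ifs <;> norm_num

lemma nRej_le {n : ℕ} (d : Fin n → Bool) : nRej d ≤ n := by
  linarith [nRej_add_nAcc d, nAcc_nonneg d]

lemma nRej_div_mem {n : ℕ} (d : Fin n → Bool) : nRej d / n ∈ Set.Icc (0 : ℝ) 1 :=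
  ⟨div_nonneg (nRej_nonneg d) (Nat.cast_nonneg n),
    div_le_one_of_le₀ (nRej_le d) (Nat.cast_nonneg n)⟩

lemma level_mem (η : ℝ) {n : ℕ} (d : Fin n → Bool) : level η d ∈ Set.Icc (0 : ℝ) 1 := by
  unfold level
  split_ifs
  · simp
  · simp
  · exact nRej_div_mem d

lemma sum_rejWeight_mul {n : ℕ} (d : Fin n → Bool) (w : Fin n → ℝ) :
    (∑ i, rejWeight d i * w i) * max 1 (nRej d) = ∑ i, (if d i then 1 else 0) * w i := by
  rw [Finset.sum_mul]
  refine Finset.sum_congr rfl fun i _ => ?_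
  have : max 1 (nRej d) ≠ 0 := (lt_of_lt_of_le one_pos (le_max_left _ _)).ne'
  rw [rejWeight]
  field_simp

lemma sum_accWeight_mul {n : ℕ} (d : Fin n → Bool) (w : Fin n → ℝ) :
    (∑ i, accWeight d i * w i) * max 1 (nAcc d) = ∑ i, (if d i then 0 else 1) * w i := by
  rw [Finset.sum_mul]
  refine Finset.sum_congr rfl fun i _ => ?_
  have : max 1 (nAcc d) ≠ 0 := (lt_of_lt_of_le one_pos (le_max_left _ _)).ne'
  rw [accWeight]
  field_simp

lemma le_of_mul_max_eq {n x y R : ℝ} (hn : 1 ≤ n) (hx : 0 ≤ x) (hR : R ≤ n)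
    (h : x * max 1 R = y) : y / n ≤ x := by
  rw [div_le_iff₀ (by linarith), ← h]
  exact mul_le_mul_of_nonneg_left (max_le hn hR) hx

lemma eq_div_of_mul_max_eq {n : ℕ} {x y R : ℝ} (hn : 0 < n) (hR : 0 < R) (hR' : ∃ k : ℕ, R = k)
    (h : x * max 1 R = y) : x = y / n / (R / n) := by
  obtain ⟨k, rfl⟩ := hR'
  have hk : (1 : ℝ) ≤ k := by
    have : 0 < k := by exact_mod_cast hR
    exact_mod_cast this
  rw [max_eq_right hk] at h
  rw [div_div_div_cancel_right₀ (by positivity), ← h]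
  field_simp

lemma exists_nRej_eq {n : ℕ} (d : Fin n → Bool) : ∃ k : ℕ, nRej d = k :=
  ⟨∑ i, if d i then 1 else 0, by simp [nRej]⟩

lemma exists_nAcc_eq {n : ℕ} (d : Fin n → Bool) : ∃ k : ℕ, nAcc d = k :=
  ⟨∑ i, if d i then 0 else 1, by push_cast; simp [nAcc]⟩

namespace Model

variable {𝒳 : Type*} [MeasurableSpace 𝒳] (M : Model 𝒳) {n : ℕ}

lemma phi_mono : Monotone M.phi := fun s t h =>
  integral_mono (M.integrable_phi s) (M.integrable_phi t) fun w =>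
    max_le_max (sub_le_sub_right h w) le_rfl

lemma low_le_add_gridDev {m : ℕ} (hm : 0 < m) (hn : 0 < n) (w : Fin n → ℝ)
    (hw : ∀ i, w i ∈ Set.Icc (0 : ℝ) 1) (d : Fin n → Bool) :
    M.low (nRej d / n) ≤ (∑ i, (if d i then 1 else 0) * w i) / n + M.gridDev m w := by
  have hu := nRej_div_mem d
  set u := nRej d / n with hu_def
  have hm' : (0 : ℝ) < m := by exact_mod_cast hm
  have hn' : (0 : ℝ) < n := by exact_mod_cast hn
  have hT := M.Ginv_mem hu
  set T := M.Ginv u with hT_def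
  set j := ⌊T * m⌋₊ with hj
  set t : ℝ := (j : ℝ) / m with ht
  have h1 : t ≤ T := by
    rw [ht, div_le_iff₀ hm']
    exact Nat.floor_le (mul_nonneg hT.1 hm'.le)
  have h2 : T ≤ t + 1 / m := by
    rw [ht, ← add_div, le_div_iff₀ hm']
    exact (Nat.lt_floor_add_one _).le
  have hjm : j ∈ Finset.range (m + 1) := by
    rw [Finset.mem_range, Nat.lt_succ_iff]
    refine Nat.floor_le_of_le ?_
    nlinarith [hT.2]
  have h3 := M.phi_mono h1
  have h4 : |(∑ i, max (t - w i) 0) / n - M.phi t| ≤ M.gridDev m w - 1 / m := by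
    rw [gridDev, add_sub_cancel_left]
    exact Finset.single_le_sum
      (f := fun j : ℕ => |(∑ i, max ((j : ℝ) / m - w i) 0) / n - M.phi (j / m)|)
      (fun _ _ => abs_nonneg _) hjm
  have h5 : u * t ≤ (∑ i, (if d i then 1 else 0) * w i) / n + (∑ i, max (t - w i) 0) / n := by
    rw [← add_div, le_div_iff₀ hn', ← Finset.sum_add_distrib, hu_def, mul_right_comm,
      div_mul_cancel₀ _ hn'.ne', nRej, Finset.sum_mul]
    refine Finset.sum_le_sum fun i _ => ?_
    have := hw i
    split_ifs
    · linarith [le_max_left (t - w i) 0]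
    · linarith [le_max_right (t - w i) 0]
  rw [M.low_eq hu, ← hT_def]
  have h6 : u * T ≤ u * t + 1 / m := by
    have : u * T ≤ u * (t + 1 / m) := mul_le_mul_of_nonneg_left h2 hu.1
    have : u * (1 / m) ≤ 1 / m := mul_le_of_le_one_left (by positivity) hu.2
    linarith
  linarith [(abs_le.1 h4).1, (abs_le.1 h4).2]

lemma abs_mean_sub_le_gridDev {m : ℕ} (hm : 0 < m) (hn : 0 < n) (w : Fin n → ℝ)
    (hw : ∀ i, w i ∈ Set.Icc (0 : ℝ) 1) : |(∑ i, w i) / n - M.meanW| ≤ M.gridDev m w := by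
  have hm' : (0 : ℝ) < m := by exact_mod_cast hm
  have hn' : (0 : ℝ) < n := by exact_mod_cast hn
  have h := Finset.single_le_sum
    (f := fun j : ℕ => |(∑ i, max ((j : ℝ) / m - w i) 0) / n - M.phi (j / m)|)
    (fun _ _ => abs_nonneg _) (Finset.self_mem_range_succ m)
  have e : (∑ i, max (1 - w i) 0) / n = 1 - (∑ i, w i) / n := by
    have : ∀ i, max (1 - w i) 0 = 1 - w i := fun i => max_eq_left (sub_nonneg.2 (hw i).2)
    simp only [this, Finset.sum_sub_distrib]
    simp only [Finset.sum_const, Finset.card_univ, Fintype.card_fin, nsmul_eq_mul, mul_one]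
    field_simp
  simp only [div_self hm'.ne', e, phi_one] at h
  rw [abs_sub_comm, show M.meanW - (∑ i, w i) / n = 1 - (∑ i, w i) / n - (1 - M.meanW) by ring]
  refine h.trans ?_
  rw [gridDev]
  exact le_add_of_nonneg_left (by positivity)

lemma gridDev_nonneg (m : ℕ) (w : Fin n → ℝ) : 0 ≤ M.gridDev m w :=
  add_nonneg (by positivity) (Finset.sum_nonneg fun _ _ => abs_nonneg _)

lemma a_b_level_le {m : ℕ} (hm : 0 < m) (hn : 0 < n) (w : Fin n → ℝ)
    (hw : ∀ i, w i ∈ Set.Icc (0 : ℝ) 1) {η : ℝ} (hη : 0 < η) (hη1 : η ≤ 1 / 2)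
    (d : Fin n → Bool) :
    M.a (level η d) ≤ ∑ i, rejWeight d i * w i + (η + 2 * M.gridDev m w / η) ∧
    M.b (level η d) ≤ ∑ i, accWeight d i * (1 - w i) + (η + 2 * M.gridDev m w / η) := by
  have hn' : (0 : ℝ) < n := by exact_mod_cast hn
  have hn1 : (1 : ℝ) ≤ n := by exact_mod_cast hn
  have hL := M.low_le_add_gridDev hm hn w hw d
  have hmean := M.abs_mean_sub_le_gridDev hm hn w hw
  have hK := M.gridDev_nonneg m w
  have hu := nRej_div_mem d
  have hacc : nAcc d / n = 1 - nRej d / n := by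
    rw [eq_sub_iff_add_eq, ← add_div, add_comm, nRej_add_nAcc, div_self hn'.ne']
  have hA := sum_rejWeight_mul d w
  have hB := sum_accWeight_mul d fun i => 1 - w i
  have hA0 : 0 ≤ ∑ i, rejWeight d i * w i :=
    Finset.sum_nonneg fun i _ => mul_nonneg (rejWeight_mem d i).1 (hw i).1
  have hB0 : 0 ≤ ∑ i, accWeight d i * (1 - w i) :=
    Finset.sum_nonneg fun i _ => mul_nonneg (accWeight_mem d i).1 (sub_nonneg.2 (hw i).2)
  have hAn := le_of_mul_max_eq hn1 hA0 (nRej_le d) hA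
  have hBn := le_of_mul_max_eq hn1 hB0 (by linarith [nRej_add_nAcc d, nRej_nonneg d]) hB
  have hsum : (∑ i, (if d i then 0 else 1) * (1 - w i)) / n =
      1 - (∑ i, w i) / n - nRej d / n + (∑ i, (if d i then 1 else 0) * w i) / n := by
    have : (∑ i, (if d i then 0 else 1) * (1 - w i)) =
        n - ∑ i, w i - nRej d + ∑ i, (if d i then 1 else 0) * w i := by
      have hc : (n : ℝ) = ∑ _i : Fin n, (1 : ℝ) := by simp
      rw [hc, nRej, ← Finset.sum_sub_distrib, ← Finset.sum_sub_distrib, ← Finset.sum_add_distrib]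
      refine Finset.sum_congr rfl fun i _ => ?_
      split_ifs <;> ring
    rw [this]
    field_simp
  have hdw0 : 0 ≤ (∑ i, (if d i then 1 else 0) * w i) / n :=
    div_nonneg (Finset.sum_nonneg fun i _ => mul_nonneg (by split_ifs <;> norm_num) (hw i).1) hn'.le
  have hcw0 : 0 ≤ (∑ i, (if d i then 0 else 1) * (1 - w i)) / n :=
    div_nonneg (Finset.sum_nonneg fun i _ =>
      mul_nonneg (by split_ifs <;> norm_num) (sub_nonneg.2 (hw i).2)) hn'.le
  have hKη : 2 * M.gridDev m w ≤ 2 * M.gridDev m w / η :=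
    le_div_self (by linarith) hη (by linarith)
  have hm1 := (abs_le.1 hmean).1
  have hm2 := (abs_le.1 hmean).2
  unfold level
  split_ifs with h1 h2
  · rw [a_zero, b_zero]
    constructor <;> linarith
  · rw [a_one, b_one]
    constructor <;> linarith
  · have hu0 : 0 < nRej d / n := by linarith
    have hu1 : 0 < 1 - nRej d / n := by linarith
    have hA' := eq_div_of_mul_max_eq hn ((div_pos_iff_of_pos_right hn').1 hu0) (exists_nRej_eq d) hA
    have hB' := eq_div_of_mul_max_eq hn ((div_pos_iff_of_pos_right hn').1 (hacc ▸ hu1))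
      (exists_nAcc_eq d) hB
    rw [hacc] at hB'
    have ea := M.mul_a hu
    have eb := M.one_sub_mul_b hu
    constructor
    · have : M.a (nRej d / n) - ∑ i, rejWeight d i * w i ≤ 2 * M.gridDev m w / (nRej d / n) := by
        rw [hA', le_div_iff₀ hu0, sub_mul, div_mul_cancel₀ _ hu0.ne']
        linarith
      have h3 : 2 * M.gridDev m w / (nRej d / n) ≤ 2 * M.gridDev m w / η :=
        div_le_div_of_nonneg_left (by linarith) hη (by linarith)
      linarith
    · have : M.b (nRej d / n) - ∑ i, accWeight d i * (1 - w i) ≤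
          2 * M.gridDev m w / (1 - nRej d / n) := by
        rw [hB', le_div_iff₀ hu1, sub_mul, div_mul_cancel₀ _ hu1.ne']
        linarith
      have h3 : 2 * M.gridDev m w / (1 - nRej d / n) ≤ 2 * M.gridDev m w / η :=
        div_le_div_of_nonneg_left (by linarith) hη (by linarith)
      linarith

lemma measurable_dev (t : ℝ) : Measurable fun ω : Fin n → Bool × 𝒳 =>
    (∑ i, max (t - M.Lfdr (ω i).2) 0) / n - M.phi t :=
  ((Finset.measurable_sum _ fun i _ => (measurable_const.sub
    (M.measurable_Lfdr_eval i)).max measurable_const).div_const _).sub_const _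

lemma integral_dev_sq_le (hn : 0 < n) {t : ℝ} (ht : t ∈ Set.Icc (0 : ℝ) 1) :
    ∫ ω, ((∑ i, max (t - M.Lfdr (ω i).2) 0) / n - M.phi t) ^ 2 ∂M.jointN n ≤ 1 / n := by
  have hn' : (0 : ℝ) < n := by exact_mod_cast hn
  let X : Bool × 𝒳 → ℝ := fun y => max (t - M.Lfdr y.2) 0
  have hXm : Measurable X := (measurable_const.sub M.measurable_Lfdr_snd).max measurable_const
  have hX (y : Bool × 𝒳) : X y ∈ Set.Icc (0 : ℝ) 1 :=
    ⟨le_max_right _ _, max_le (by linarith [ht.2, M.Lfdr_nonneg y.2]) zero_le_one⟩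
  have hXL : MemLp X 2 M.joint := MemLp.of_bound hXm.aestronglyMeasurable 1 (ae_of_all _ fun y => by
    rw [Real.norm_eq_abs, abs_of_nonneg (hX y).1]; exact (hX y).2)
  have hXi : Integrable X M.joint := hXL.integrable one_le_two
  have hphi : ∫ y, X y ∂M.joint = M.phi t :=
    M.integral_comp_Lfdr (h := fun w => max (t - w) 0)
      ((measurable_const.sub measurable_id).max measurable_const)
  have hvar : variance X M.joint ≤ 1 := by
    have := variance_le_sq_of_bounded (μ := M.joint) (X := X) (a := 0) (b := 1)
      (ae_of_all _ hX) hXm.aemeasurable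
    norm_num at this
    linarith
  have hS : variance (∑ i, fun ω : Fin n → Bool × 𝒳 => X (ω i)) (M.jointN n) =
      ∑ _i : Fin n, variance X M.joint :=
    variance_sum_pi (μ := fun _ : Fin n => M.joint) (X := fun _ => X) fun _ => hXL
  have hmean : ∫ ω, (∑ i, fun ω : Fin n → Bool × 𝒳 => X (ω i)) ω ∂M.jointN n = n * M.phi t := by
    simp only [Finset.sum_apply]
    rw [integral_finsetSum]
    · have e (i : Fin n) : ∫ ω, X (ω i) ∂M.jointN n = M.phi t := by
        rw [← hphi, jointN, integral_comp_eval (μ := fun _ : Fin n => M.joint) (i := i)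
          hXm.aestronglyMeasurable]
      simp [e]
    · exact fun i _ => integrable_comp_eval (μ := fun _ : Fin n => M.joint) (i := i) hXi
  have hmeas : Measurable (∑ i, fun ω : Fin n → Bool × 𝒳 => X (ω i)) := by
    rw [show (∑ i, fun ω : Fin n → Bool × 𝒳 => X (ω i)) = fun ω => ∑ i, X (ω i) by ext; simp]
    exact Finset.measurable_sum _ fun i _ => hXm.comp (measurable_pi_apply i)
  rw [variance_eq_integral hmeas.aemeasurable, hmean] at hS
  have e (ω : Fin n → Bool × 𝒳) : ((∑ i, max (t - M.Lfdr (ω i).2) 0) / n - M.phi t) ^ 2 =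
      (1 / (n : ℝ) ^ 2) *
        ((∑ i, fun ω : Fin n → Bool × 𝒳 => X (ω i)) ω - n * M.phi t) ^ 2 := by
    simp only [Finset.sum_apply, X]
    field_simp
  simp only [e]
  rw [integral_const_mul, hS]
  simp only [Finset.sum_const, Finset.card_univ, Fintype.card_fin, nsmul_eq_mul]
  rw [div_mul_eq_mul_div, one_mul, div_le_div_iff₀ (by positivity) hn']
  nlinarith [mul_le_mul_of_nonneg_left hvar (sq_nonneg (n : ℝ))]

lemma integrable_dev {t : ℝ} (ht : t ∈ Set.Icc (0 : ℝ) 1) (k : ℕ) :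
    Integrable (fun ω : Fin n → Bool × 𝒳 =>
      |(∑ i, max (t - M.Lfdr (ω i).2) 0) / n - M.phi t| ^ k) (M.jointN n) := by
  refine Integrable.of_bound (C := (1 + |M.phi t|) ^ k)
    ((M.measurable_dev t).norm.pow_const k).aestronglyMeasurable (ae_of_all _ fun ω => ?_)
  rw [Real.norm_eq_abs, abs_pow, abs_abs]
  refine pow_le_pow_left₀ (abs_nonneg _) ((abs_sub _ _).trans (add_le_add_left ?_ _)) k
  rw [abs_of_nonneg (div_nonneg (Finset.sum_nonneg fun i _ => le_max_right _ _)
    (Nat.cast_nonneg n))]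
  refine div_le_one_of_le₀ ?_ (Nat.cast_nonneg n)
  calc ∑ i, max (t - M.Lfdr (ω i).2) 0 ≤ ∑ _i : Fin n, (1 : ℝ) :=
        Finset.sum_le_sum fun i _ =>
          max_le (by linarith [ht.2, M.Lfdr_nonneg (ω i).2]) zero_le_one
    _ = n := by simp

lemma grid_mem {m j : ℕ} (hj : j ∈ Finset.range (m + 1)) : (j : ℝ) / m ∈ Set.Icc (0 : ℝ) 1 :=
  ⟨by positivity, div_le_one_of_le₀
    (by exact_mod_cast Nat.lt_succ_iff.1 (Finset.mem_range.1 hj)) (Nat.cast_nonneg m)⟩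

lemma integrable_gridDev (m : ℕ) :
    Integrable (fun ω : Fin n → Bool × 𝒳 => M.gridDev m fun i => M.Lfdr (ω i).2) (M.jointN n) := by
  refine (integrable_const _).add (integrable_finsetSum _ fun j hj => ?_)
  simpa using M.integrable_dev (n := n) (grid_mem hj) 1

lemma integral_gridDev_le (hn : 0 < n) (m : ℕ) {c : ℝ} (hc : 0 < c) :
    ∫ ω, M.gridDev m (fun i => M.Lfdr (ω i).2) ∂M.jointN n ≤
      1 / m + (m + 1) * (c + 1 / (n * c)) := by
  have i1 (j : ℕ) (hj : j ∈ Finset.range (m + 1)) : Integrable (fun ω : Fin n → Bool × 𝒳 =>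
      |(∑ i, max ((j : ℝ) / m - M.Lfdr (ω i).2) 0) / n - M.phi (j / m)|) (M.jointN n) := by
    simpa using M.integrable_dev (n := n) (grid_mem hj) 1
  have i2 (j : ℕ) (hj : j ∈ Finset.range (m + 1)) : Integrable (fun ω : Fin n → Bool × 𝒳 =>
      ((∑ i, max ((j : ℝ) / m - M.Lfdr (ω i).2) 0) / n - M.phi (j / m)) ^ 2) (M.jointN n) := by
    simpa using M.integrable_dev (n := n) (grid_mem hj) 2
  simp only [gridDev]
  rw [integral_add (integrable_const _) (integrable_finsetSum _ i1), integral_finsetSum _ i1]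
  simp only [integral_const, probReal_univ, one_smul]
  refine add_le_add le_rfl ?_
  calc _ ≤ ∑ _j ∈ Finset.range (m + 1), (c + 1 / (n * c)) := by
        refine Finset.sum_le_sum fun j hj => ?_
        have h := M.integral_dev_sq_le hn (grid_mem hj)
        calc _ ≤ ∫ ω, (c + (1 / c) * ((∑ i, max ((j : ℝ) / m - M.Lfdr (ω i).2) 0) / n -
              M.phi (j / m)) ^ 2) ∂M.jointN n := by
              refine integral_mono (i1 j hj)
                ((integrable_const c).add ((i2 j hj).const_mul _)) fun ω => ?_
              simp only
              set z := (∑ i, max ((j : ℝ) / m - M.Lfdr (ω i).2) 0) / n - M.phi (j / m)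
              rw [div_mul_eq_mul_div, one_mul, ← sub_le_iff_le_add', le_div_iff₀ hc, ← sq_abs z]
              nlinarith [abs_nonneg z, sq_nonneg (|z| - c)]
          _ ≤ _ := by
              rw [integral_add (integrable_const c) ((i2 j hj).const_mul _), integral_const_mul]
              simp only [integral_const, probReal_univ, one_smul]
              refine add_le_add le_rfl ?_
              rw [show 1 / ((n : ℝ) * c) = 1 / c * (1 / n) by rw [one_div_mul_one_div, mul_comm]]
              exact mul_le_mul_of_nonneg_left h (by positivity)
    _ = _ := by simp [mul_add]

lemma eventually_integral_gridDev_le {ε : ℝ} (hε : 0 < ε) : ∃ m : ℕ, 0 < m ∧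
    ∀ᶠ n : ℕ in atTop, ∫ ω, M.gridDev m (fun i => M.Lfdr (ω i).2) ∂M.jointN n ≤ ε := by
  obtain ⟨k, hk⟩ := exists_nat_one_div_lt (show (0 : ℝ) < ε / 3 by positivity)
  refine ⟨k + 1, k.succ_pos, ?_⟩
  set m : ℕ := k + 1 with hm
  have hm' : 1 / (m : ℝ) < ε / 3 := by rw [hm]; exact_mod_cast hk
  set c : ℝ := ε / (3 * (m + 1)) with hc
  have hc0 : 0 < c := by positivity
  have hc1 : (m + 1) * c = ε / 3 := by
    rw [hc]
    field_simp
  have ht : Tendsto (fun n : ℕ => (m + 1) / c * (1 / (n : ℝ))) atTop (nhds 0) := by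
    simpa using (tendsto_one_div_atTop_nhds_zero_nat (𝕜 := ℝ)).const_mul ((m + 1) / c)
  filter_upwards [ht.eventually (gt_mem_nhds (show (0 : ℝ) < ε / 3 by positivity)),
    eventually_gt_atTop 0] with n h1 h2
  refine (M.integral_gridDev_le h2 m hc0).trans ?_
  have h3 : ((m : ℝ) + 1) * (1 / (n * c)) = (m + 1) / c * (1 / n) := by
    have : (n : ℝ) ≠ 0 := by exact_mod_cast h2.ne'
    field_simp
  rw [mul_add, h3, hc1]
  linarith

end Model

namespace Model

variable {𝒳 : Type*} [MeasurableSpace 𝒳] (M : Model 𝒳) {n : ℕ}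
  {κ : (Fin n → 𝒳) → Measure (Fin n → Bool)}

/-- The law of the level `level η δ` when the decision vector `δ` is drawn by the rule `κ`. -/
noncomputable def levelLaw (κ : (Fin n → 𝒳) → Measure (Fin n → Bool)) (η : ℝ) : Measure ℝ :=
  ∑ d, ENNReal.ofReal (∫ ω, (κ fun i => (ω i).2).real {d} ∂M.jointN n) •
    Measure.dirac (level η d)

lemma integrable_rule (hκ : IsRule κ) (d : Fin n → Bool) :
    Integrable (fun ω => (κ fun i => (ω i).2).real {d}) (M.jointN n) := by
  simpa using M.integrable_rule_mul hκ d (h := fun _ => 1) measurable_const 1 (by simp)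

lemma sum_integral_rule (hκ : IsRule κ) :
    ∑ d, ∫ ω, (κ fun i => (ω i).2).real {d} ∂M.jointN n = 1 := by
  rw [← integral_finsetSum _ fun d _ => M.integrable_rule hκ d]
  have e (ω : Fin n → Bool × 𝒳) : ∑ d, (κ fun i => (ω i).2).real {d} = 1 := by
    have := hκ.2 fun i => (ω i).2
    simp
  simp only [e, integral_const, probReal_univ, one_smul]

lemma isProbabilityMeasure_levelLaw (hκ : IsRule κ) (η : ℝ) :
    IsProbabilityMeasure (M.levelLaw κ η) := by
  refine ⟨?_⟩
  simp only [levelLaw, Measure.finsetSum_apply, Measure.smul_apply, smul_eq_mul, measure_univ,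
    mul_one]
  rw [← ENNReal.ofReal_sum_of_nonneg fun d _ => integral_nonneg fun ω => measureReal_nonneg,
    M.sum_integral_rule hκ, ENNReal.ofReal_one]

lemma ae_levelLaw_mem (κ : (Fin n → 𝒳) → Measure (Fin n → Bool)) (η : ℝ) :
    ∀ᵐ u ∂M.levelLaw κ η, u ∈ Set.Icc (0 : ℝ) 1 := by
  rw [ae_iff]
  simp only [levelLaw, Measure.finsetSum_apply, Measure.smul_apply, smul_eq_mul]
  refine Finset.sum_eq_zero fun d _ => ?_
  rw [Measure.dirac_apply, Set.indicator_of_notMem (by simpa using level_mem η d), mul_zero]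

lemma integral_levelLaw (κ : (Fin n → 𝒳) → Measure (Fin n → Bool)) (η : ℝ) (r : ℝ → ℝ) :
    ∫ u, r u ∂M.levelLaw κ η =
      ∑ d, (∫ ω, (κ fun i => (ω i).2).real {d} ∂M.jointN n) * r (level η d) := by
  rw [levelLaw, integral_finsetSum_measure]
  · refine Finset.sum_congr rfl fun d _ => ?_
    rw [integral_smul_measure, integral_dirac,
      ENNReal.toReal_ofReal (integral_nonneg fun ω => measureReal_nonneg), smul_eq_mul]
  · exact fun d _ => (integrable_dirac (by simp)).smul_measure ENNReal.ofReal_ne_top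

lemma sum_integral_rule_mul_le (hκ : IsRule κ) {r : (Fin n → Bool) → ℝ}
    (c : (Fin n → Bool) → Fin n → ℝ) {v : ℝ → ℝ} (hv : Measurable v)
    (hv1 : ∀ w ∈ Set.Icc (0 : ℝ) 1, |v w| ≤ 1) {e : (Fin n → Bool × 𝒳) → ℝ}
    (he : Integrable e (M.jointN n))
    (h : ∀ d ω, r d ≤ ∑ i, c d i * v (M.Lfdr (ω i).2) + e ω) :
    ∑ d, (∫ ω, (κ fun i => (ω i).2).real {d} ∂M.jointN n) * r d ≤
      ∑ d, ∑ i, c d i * (∫ ω, (κ fun i => (ω i).2).real {d} * v (M.Lfdr (ω i).2) ∂M.jointN n) +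
        ∫ ω, e ω ∂M.jointN n := by
  have hi (d : Fin n → Bool) (i : Fin n) : Integrable (fun ω : Fin n → Bool × 𝒳 =>
      c d i * ((κ fun i => (ω i).2).real {d} * v (M.Lfdr (ω i).2))) (M.jointN n) :=
    (M.integrable_rule_mul hκ d (hv.comp (M.measurable_Lfdr_eval i)) 1
      fun ω => hv1 _ ⟨M.Lfdr_nonneg _, M.Lfdr_le_one _⟩).const_mul _
  have hie (d : Fin n → Bool) :
      Integrable (fun ω => (κ fun i => (ω i).2).real {d} * e ω) (M.jointN n) :=
    he.bdd_mul (c := 1)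
      ((hκ.measurable_real d).comp (measurable_snd_pi n)).aestronglyMeasurable
      (ae_of_all _ fun ω => by
        rw [Real.norm_eq_abs]
        exact (abs_of_nonneg measureReal_nonneg).trans_le (hκ.real_le_one _ d))
  have hs : ∫ ω, e ω ∂M.jointN n =
      ∑ d, ∫ ω, (κ fun i => (ω i).2).real {d} * e ω ∂M.jointN n := by
    rw [← integral_finsetSum _ fun d _ => hie d]
    refine integral_congr_ae (ae_of_all _ fun ω => ?_)
    have := hκ.2 fun i => (ω i).2
    simp only [← Finset.sum_mul]
    simp
  rw [hs, ← Finset.sum_add_distrib]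
  refine Finset.sum_le_sum fun d _ => ?_
  simp only [← integral_const_mul]
  rw [← integral_mul_const, ← integral_finsetSum _ fun i _ => hi d i,
    ← integral_add (integrable_finsetSum _ fun i _ => hi d i) (hie d)]
  refine integral_mono ((M.integrable_rule hκ d).mul_const _)
    ((integrable_finsetSum _ fun i _ => hi d i).add (hie d)) fun ω => ?_
  have h1 := mul_le_mul_of_nonneg_left (h d ω)
    (measureReal_nonneg (μ := κ fun i => (ω i).2) (s := {d}))
  refine h1.trans_eq ?_
  rw [mul_add, Finset.mul_sum]
  exact congrArg (· + _) (Finset.sum_congr rfl fun i _ => mul_left_comm _ _ _)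

lemma integral_levelLaw_le (hκ : IsRule κ) {m : ℕ} (hm : 0 < m) (hn : 0 < n) {η : ℝ}
    (hη : 0 < η) (hη1 : η ≤ 1 / 2) :
    (∫ u, M.a u ∂M.levelLaw κ η ≤ M.FDR n κ +
      (η + 2 * (∫ ω, M.gridDev m (fun i => M.Lfdr (ω i).2) ∂M.jointN n) / η)) ∧
    (∫ u, M.b u ∂M.levelLaw κ η ≤ M.FNR n κ +
      (η + 2 * (∫ ω, M.gridDev m (fun i => M.Lfdr (ω i).2) ∂M.jointN n) / η)) := by
  have hi : Integrable (fun ω : Fin n → Bool × 𝒳 =>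
      2 * M.gridDev m (fun i => M.Lfdr (ω i).2) / η) (M.jointN n) :=
    ((M.integrable_gridDev m).const_mul 2).div_const η
  have he := (integrable_const (μ := M.jointN n) η).add hi
  have e : ∫ ω, (η + 2 * M.gridDev m (fun i => M.Lfdr (ω i).2) / η) ∂M.jointN n =
      η + 2 * (∫ ω, M.gridDev m (fun i => M.Lfdr (ω i).2) ∂M.jointN n) / η := by
    rw [integral_add (integrable_const η) hi, integral_div, integral_const_mul]
    simp
  have hW (ω : Fin n → Bool × 𝒳) (i : Fin n) : M.Lfdr (ω i).2 ∈ Set.Icc (0 : ℝ) 1 :=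
    ⟨M.Lfdr_nonneg _, M.Lfdr_le_one _⟩
  have key (d : Fin n → Bool) (ω : Fin n → Bool × 𝒳) :=
    M.a_b_level_le hm hn (fun i => M.Lfdr (ω i).2) (hW ω) hη hη1 d
  rw [integral_levelLaw, integral_levelLaw, ← e, M.FDR_eq_sum hκ, M.FNR_eq_sum hκ]
  exact ⟨M.sum_integral_rule_mul_le hκ rejWeight (v := fun w => w) measurable_id
      (fun w hw => by rw [abs_of_nonneg hw.1]; exact hw.2) he fun d ω => (key d ω).1,
    M.sum_integral_rule_mul_le hκ accWeight (v := fun w => 1 - w)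
      (measurable_const.sub measurable_id)
      (fun w hw => by rw [abs_of_nonneg (sub_nonneg.2 hw.2)]; linarith [hw.1]) he
      fun d ω => (key d ω).2⟩

lemma eventually_exists_levelLaw {ε : ℝ} (hε : 0 < ε) : ∀ᶠ n : ℕ in atTop,
    ∀ κ : (Fin n → 𝒳) → Measure (Fin n → Bool), IsRule κ → ∃ ρ : Measure ℝ,
      IsProbabilityMeasure ρ ∧ (∀ᵐ u ∂ρ, u ∈ Set.Icc (0 : ℝ) 1) ∧
      ∫ u, M.a u ∂ρ ≤ M.FDR n κ + ε ∧ ∫ u, M.b u ∂ρ ≤ M.FNR n κ + ε := by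
  set η : ℝ := min (ε / 2) (1 / 2) with hη
  have hη0 : 0 < η := lt_min (by positivity) (by norm_num)
  have hη1 : η ≤ ε / 2 := min_le_left _ _
  obtain ⟨m, hm, h⟩ := M.eventually_integral_gridDev_le (show 0 < ε * η / 4 by positivity)
  filter_upwards [h, eventually_gt_atTop 0] with n h hn κ hκ
  obtain ⟨h1, h2⟩ := M.integral_levelLaw_le hκ hm hn hη0 (min_le_right _ _)
  have h3 : 2 * (∫ ω, M.gridDev m (fun i => M.Lfdr (ω i).2) ∂M.jointN n) / η ≤ ε / 2 := by
    rw [div_le_iff₀ hη0]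
    linarith
  exact ⟨M.levelLaw κ η, M.isProbabilityMeasure_levelLaw hκ η, M.ae_levelLaw_mem κ η,
    by linarith, by linarith⟩

variable {ρ : Measure ℝ}

lemma bstarstar_le_add_of_pos {α δ : ℝ} (hα : 0 < α) (hδ : 0 ≤ δ) [IsProbabilityMeasure ρ]
    (hρ : ∀ᵐ u ∂ρ, u ∈ Set.Icc (0 : ℝ) 1) (ha : ∫ u, M.a u ∂ρ ≤ α + δ) :
    M.bstarstar α ≤ ∫ u, M.b u ∂ρ + δ / α := by
  set l : ℝ := α / (α + δ) with hl
  have hl0 : 0 ≤ l := by positivity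
  have hl1 : l ≤ 1 := div_le_one_of_le₀ (by linarith) (by linarith)
  let σ : Measure ℝ := ENNReal.ofReal l • ρ + ENNReal.ofReal (1 - l) • Measure.dirac 0
  have hσp : IsProbabilityMeasure σ := ⟨by
    simp only [σ, Measure.add_apply, Measure.smul_apply, smul_eq_mul, measure_univ, mul_one]
    rw [← ENNReal.ofReal_add hl0 (by linarith)]
    simp⟩
  have hσ : ∀ᵐ u ∂σ, u ∈ Set.Icc (0 : ℝ) 1 := by
    rw [ae_add_measure_iff]
    exact ⟨Measure.ae_smul_measure hρ _, Measure.ae_smul_measure (by simp [ae_dirac_eq]) _⟩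
  have hi {r : ℝ → ℝ} (hr : Integrable r ρ) :
      ∫ u, r u ∂σ = l * ∫ u, r u ∂ρ + (1 - l) * r 0 := by
    rw [integral_add_measure (hr.smul_measure ENNReal.ofReal_ne_top)
      ((integrable_dirac (by simp)).smul_measure ENNReal.ofReal_ne_top), integral_smul_measure,
      integral_smul_measure, integral_dirac, ENNReal.toReal_ofReal hl0,
      ENNReal.toReal_ofReal (by linarith), smul_eq_mul, smul_eq_mul]
  have hb0 : 0 ≤ ∫ u, M.b u ∂ρ :=
    integral_nonneg_of_ae (hρ.mono fun u hu => (M.b_mem hu).1)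
  have hlδ : 1 - l ≤ δ / α := by
    rw [hl, one_sub_div (by positivity), add_sub_cancel_left]
    exact div_le_div_of_nonneg_left hδ hα (by linarith)
  refine (M.bstarstar_le hσ ?_).trans ?_
  · rw [hi (M.integrable_a hρ), M.a_zero, mul_zero, add_zero]
    refine (mul_le_mul_of_nonneg_left ha hl0).trans_eq ?_
    rw [hl, div_mul_cancel₀ _ (by positivity)]
  · rw [hi (M.integrable_b hρ)]
    have := M.b_mem (u := 0) (by simp)
    nlinarith [mul_nonneg (sub_nonneg.2 hl1) (sub_nonneg.2 this.2),
      mul_nonneg (sub_nonneg.2 hl1) hb0]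

lemma low_G_zero : M.low (M.G 0) = 0 := by
  have h : M.G 0 ∈ Set.Icc (0 : ℝ) 1 := ⟨M.G_nonneg 0, M.G_le_one 0⟩
  have h1 : M.Ginv (M.G 0) = 0 := by
    refine le_antisymm ?_ (M.Ginv_mem h).1
    rcases h.1.eq_or_lt with h0 | h0
    · exact (M.Ginv_of_nonpos h0.ge).le
    · exact M.Ginv_le_of_le_G h0 le_rfl
  refine le_antisymm ?_ (M.low_nonneg h)
  rw [M.low_eq h, h1]
  linarith [M.phi_nonneg 0]

lemma a_G_zero : M.a (M.G 0) = 0 := by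
  rcases (M.G_nonneg 0).eq_or_lt with h | h
  · rw [← h, M.a_zero]
  · have := M.mul_a ⟨M.G_nonneg 0, M.G_le_one 0⟩
    rw [M.low_G_zero] at this
    exact (mul_eq_zero.1 this).resolve_left h.ne'

lemma bstarstar_zero_le : M.bstarstar 0 ≤ M.b (M.G 0) := by
  simpa using M.bstarstar_le (α := 0) (ρ := Measure.dirac (M.G 0))
    (by simp [ae_dirac_eq, M.G_nonneg, M.G_le_one]) (by simp [M.a_G_zero])

lemma phi_le {t : ℝ} (ht : 0 ≤ t) : M.phi t ≤ t * M.G t := by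
  have h : M.phi t ≤ ∫ w, (Set.Iic t).indicator (fun _ => t) w ∂M.νW := by
    refine integral_mono_ae (M.integrable_phi t)
      ((integrable_const t).indicator measurableSet_Iic) (M.ae_νW_mem.mono fun w hw => ?_)
    by_cases h : w ≤ t
    · rw [Set.indicator_of_mem (by exact h)]
      exact max_le (by linarith [hw.1]) ht
    · rw [Set.indicator_of_notMem (by exact h)]
      exact max_le (by linarith) le_rfl
  refine h.trans_eq ?_
  rw [integral_indicator_const _ measurableSet_Iic, smul_eq_mul, mul_comm]
  rfl

lemma exists_G_lt {u : ℝ} (hu : M.G 0 < u) : ∃ t, 0 < t ∧ M.G t < u := by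
  have h : ContinuousWithinAt M.G (Set.Ioi 0) 0 := by
    have e : M.G = cdf M.νW := funext M.G_eq_cdf
    rw [e]
    exact ((cdf M.νW).right_continuous 0).mono Set.Ioi_subset_Ici_self
  obtain ⟨t, h1, h2⟩ := ((h.eventually (gt_mem_nhds hu)).and self_mem_nhdsWithin).exists
  exact ⟨t, h2, h1⟩

lemma b_G_zero_le {ε : ℝ} (hε : 0 < ε) : ∃ C : ℝ, 0 < C ∧ ∀ u ∈ Set.Icc (0 : ℝ) 1,
    M.b (M.G 0) ≤ M.b u + ε + C * M.a u := by
  have hG : M.G 0 ∈ Set.Icc (0 : ℝ) 1 := ⟨M.G_nonneg 0, M.G_le_one 0⟩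
  rcases hG.2.eq_or_lt with h1 | h1
  · refine ⟨1, one_pos, fun u hu => ?_⟩
    rw [h1, M.b_one]
    linarith [(M.a_mem hu).1, (M.b_mem hu).1]
  have hb := M.one_sub_mul_b hG
  rw [M.low_G_zero, add_zero] at hb
  have hbm := M.b_mem hG
  have hm := M.meanW_mem
  set g := M.G 0 with hg
  set δ : ℝ := ε * (1 - g) / (1 + ε) with hδ
  have hδ0 : 0 < δ := div_pos (mul_pos hε (by linarith)) (by linarith)
  obtain ⟨t, ht0, ht⟩ := M.exists_G_lt (u := g + δ / 2) (by linarith)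
  refine ⟨2 / (t * δ), by positivity, fun u hu => ?_⟩
  have ha := M.a_mem hu
  have hbu := M.b_mem hu
  rcases le_or_gt u (g + δ) with h | h
  · have hδ' : δ * (1 + ε) = ε * (1 - g) := by rw [hδ]; field_simp
    have hu1 : u < 1 := by nlinarith
    have h2 := M.one_sub_mul_b hu
    have h3 := M.low_nonneg hu
    have h4 : 0 ≤ 2 / (t * δ) * M.a u := mul_nonneg (by positivity) ha.1
    have h5 : δ ≤ ε * (1 - u) := by nlinarith
    have h6 : (1 - u) * M.b g ≤ (1 - u) * (M.b u + ε) := by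
      nlinarith [mul_nonneg hδ0.le hbm.1,
        mul_nonneg (show 0 ≤ g + δ - u by linarith) (sub_nonneg.2 hbm.2)]
    linarith [le_of_mul_le_mul_left h6 (by linarith)]
  · have h2 := M.le_low hu t
    have h3 := M.phi_le ht0.le
    have h4 : t * δ / 2 ≤ M.a u := by
      have := M.mul_a hu
      nlinarith [mul_le_of_le_one_left ha.1 hu.2, mul_pos ht0 hδ0,
        mul_nonneg ht0.le (show 0 ≤ u - M.G t - δ / 2 by linarith)]
    have h5 : 1 ≤ 2 / (t * δ) * M.a u := by
      rw [div_mul_eq_mul_div, le_div_iff₀ (by positivity)]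
      linarith
    linarith [hbm.2, hbu.1]

lemma exists_bstarstar_le_add {α ε : ℝ} (hα : 0 ≤ α) (hε : 0 < ε) : ∃ δ > 0, ∀ ρ : Measure ℝ,
    IsProbabilityMeasure ρ → (∀ᵐ u ∂ρ, u ∈ Set.Icc (0 : ℝ) 1) → ∫ u, M.a u ∂ρ ≤ α + δ →
      M.bstarstar α ≤ ∫ u, M.b u ∂ρ + ε := by
  rcases hα.eq_or_lt with rfl | hα
  · obtain ⟨C, hC, h⟩ := M.b_G_zero_le (half_pos hε)
    refine ⟨ε / (2 * C), by positivity, fun ρ h1 hρ ha => M.bstarstar_zero_le.trans ?_⟩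
    have hib : Integrable (fun u => M.b u + ε / 2) ρ :=
      (M.integrable_b hρ).add (integrable_const _)
    have hi : Integrable (fun u => M.b u + ε / 2 + C * M.a u) ρ :=
      hib.add ((M.integrable_a hρ).const_mul C)
    have h2 : M.b (M.G 0) ≤ ∫ u, (M.b u + ε / 2 + C * M.a u) ∂ρ := by
      have := integral_mono_ae (integrable_const (M.b (M.G 0))) hi (hρ.mono h)
      simpa using this
    rw [integral_add hib ((M.integrable_a hρ).const_mul C),
      integral_add (M.integrable_b hρ) (integrable_const _), integral_const_mul] at h2
    have h3 : C * ∫ u, M.a u ∂ρ ≤ ε / 2 := by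
      refine (mul_le_mul_of_nonneg_left ha hC.le).trans_eq ?_
      field_simp
      ring
    simp only [integral_const, probReal_univ, one_smul] at h2
    linarith
  · refine ⟨ε * α, by positivity, fun ρ h1 hρ ha => ?_⟩
    have := M.bstarstar_le_add_of_pos hα (by positivity) hρ ha
    rwa [mul_div_cancel_right₀ _ hα.ne'] at this

lemma eventually_bstarstar_le_FNRstar_add {α ε : ℝ} (hα : 0 ≤ α) (hε : 0 < ε) :
    ∀ᶠ n : ℕ in atTop, M.bstarstar α ≤ M.FNRstar n α + ε := by
  obtain ⟨δ, hδ, h⟩ := M.exists_bstarstar_le_add hα (half_pos hε)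
  filter_upwards [M.eventually_exists_levelLaw (lt_min hδ (half_pos hε))] with n hn
  rw [← sub_le_iff_le_add]
  have h0 : ∀ᵐ u ∂Measure.dirac (0 : ℝ), u ∈ Set.Icc (0 : ℝ) 1 := by simp [ae_dirac_eq]
  refine le_csInf ⟨_, M.mixRule n (Measure.dirac 0), M.isRule_mixRule h0,
    (M.FDR_mixRule_le h0).trans (by simpa [a_zero] using hα), rfl⟩ ?_
  rintro _ ⟨κ, hκ, hF, rfl⟩
  obtain ⟨ρ, h1, hρ, ha, hb⟩ := hn κ hκ
  have := h ρ h1 hρ (by linarith [min_le_left δ (ε / 2)])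
  linarith [min_le_right δ (ε / 2)]

end Model

/-- **Asymptotics of the optimal FNR** (Proposition 2). For every `α ∈ [0,1]`, the limit
`lim_{n→∞} FNR*_n(α)` exists and equals `b**(α)`. -/
theorem FNRstar_tendsto_bstarstar {𝒳 : Type*} [MeasurableSpace 𝒳] (M : Model 𝒳) :
    ∀ α ∈ Set.Icc (0 : ℝ) 1,
      Filter.Tendsto (fun n => M.FNRstar n α) Filter.atTop (nhds (M.bstarstar α)) := by
  intro α hα
  refine tendsto_order.2 ⟨fun x hx => ?_, fun x hx =>
    Eventually.of_forall fun n => (M.FNRstar_le_bstarstar n hα.1).trans_lt hx⟩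
  filter_upwards [M.eventually_bstarstar_le_FNRstar_add hα.1
    (half_pos (sub_pos.2 hx))] with n hn
  linarith

end TwoGroup
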